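/- arXiv:1012.5087 — 2 statements merged into one kernel-verified Lean document; each statement's English description precedes it below -/
import Mathlib

section
/- Let p be a prime and n ≥ 2. Let f, g ∈ ℤ_p[x_1,…,x_n] be nonzero polynomials with f(0) = 0 and g(0) = 0. Suppose f and g are both non-degenerated over F_p with respect to all faces of their Newton polyhedra, and that the pair (f,g) is non-degenerated over F_p with respect to all cones of the partition D_{f,g}. Then for every complex s with Re(s) > 0, Z_{f,g}(s) = ∫_{ℤ_p^n} |f(x)|^s |g(x)| dμ = Σ_{δ ∈ D_{f,g}} L_δ(s) S_δ(s), where for each δ ∈ D_{f,g}: L_δ(s) = p^{-n}((p−1)^n − p·N_δ·(p^s−1)/(p^{s+1}−1) − P_δ·p/(p+1) − p·Q_δ·(p^s(p+1)−2)/((p^{s+1}−1)(p+1))) with N_δ = #{a ∈ (F_p^×)^n : f̄_δ(a)=0, ḡ_δ(a)≠0}, P_δ = #{a ∈ (F_p^×)^n : f̄_δ(a)≠0, ḡ_δ(a)=0}, Q_δ = #{a ∈ (F_p^×)^n : f̄_δ(a)=ḡ_δ(a)=0}; and S_δ(s) = Σ_{k ∈ ℕ^n ∩ δ} p^{−m_f(k)s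 − m_g(k) − σ(k)}, this series converging absolutely. -/
open MeasureTheory MvPolynomial

/-! Igusa's local zeta function of a single polynomial `f` and a polynomial
measure `|g(x)||dx|`, for `f`, `g` and the pair `(f,g)` non-degenerated over
`𝔽_p` with respect to their Newton polyhedra (Theorem 4.2 / `formule_Zfgs`). -/

noncomputable instance (p : ℕ) [Fact p.Prime] : MeasurableSpace ℤ_[p] := borel _
instance (p : ℕ) [Fact p.Prime] : BorelSpace ℤ_[p] := ⟨rfl⟩

/-- The Haar measure on `ℤ_p^n`, normalized so that `μ(ℤ_p^n) = 1`. -/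
noncomputable def padicHaar (p : ℕ) [Fact p.Prime] (n : ℕ) : Measure (Fin n → ℤ_[p]) :=
  Measure.addHaarMeasure ⟨⟨Set.univ, isCompact_univ⟩, by simp⟩

/-- The nonnegative orthant `ℝ_{≥0}^n`. -/
def orthant (n : ℕ) : Set (Fin n → ℝ) := {x | ∀ i, 0 ≤ x i}

/-- Embedding of exponent vectors into `ℝ^n`. -/
def toR {n : ℕ} (ω : Fin n →₀ ℕ) : Fin n → ℝ := fun i => (ω i : ℝ)

/-- Embedding of `ℕ^n` into `ℝ^n`. -/
def toRn {n : ℕ} (k : Fin n → ℕ) : Fin n → ℝ := fun i => (k i : ℝ)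

/-- `σ(k) = k_1 + ⋯ + k_n`. -/
def sigmaFn {n : ℕ} (k : Fin n → ℕ) : ℝ := ∑ i, (k i : ℝ)

/-- The Newton polyhedron `Γ(f)`: the convex hull of `⋃_{ω ∈ supp f} (ω + ℝ_{≥0}^n)`. -/
noncomputable def newtonPoly {p n : ℕ} [Fact p.Prime] (f : MvPolynomial (Fin n) ℤ_[p]) :
    Set (Fin n → ℝ) :=
  convexHull ℝ (⋃ ω ∈ f.support, (fun c => toR ω + c) '' orthant n)

/-- `m_Γ(k) = inf_{x ∈ Γ} k·x`. -/
noncomputable def mP {n : ℕ} (Γ : Set (Fin n → ℝ)) (k : Fin n → ℝ) : ℝ :=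
  sInf ((fun x => ∑ i, k i * x i) '' Γ)

/-- The first meet locus `F_Γ(k) = {x ∈ Γ | k·x = m_Γ(k)}`. -/
noncomputable def faceOf {n : ℕ} (Γ : Set (Fin n → ℝ)) (k : Fin n → ℝ) : Set (Fin n → ℝ) :=
  {x ∈ Γ | ∑ i, k i * x i = mP Γ k}

open Classical in
/-- `f_τ` for `τ = F_{Γ(f)}(k)`: the sum of the terms of `f` supported on the
first meet locus of `k`. -/
noncomputable def facePoly {p n : ℕ} [Fact p.Prime] (f : MvPolynomial (Fin n) ℤ_[p])
    (k : Fin n → ℝ) : MvPolynomial (Fin n) ℤ_[p] :=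
  (f.support.filter (fun ω => toR ω ∈ faceOf (newtonPoly f) k)).sum
    (fun ω => monomial ω (f.coeff ω))

/-- Reduction of a polynomial over `ℤ_p` modulo `p`. -/
noncomputable def redp {p n : ℕ} [Fact p.Prime] (f : MvPolynomial (Fin n) ℤ_[p]) :
    MvPolynomial (Fin n) (ZMod p) :=
  f.map (PadicInt.toZMod)

/-- `f` is non-degenerated over `𝔽_p` with respect to all the faces of its Newton
polyhedron: for every face `τ = F_f(k)` (`k` in the orthant; `k = 0` gives `Γ(f)` itself),
the congruences `f_τ ≡ 0`, `∂f_τ/∂x_i ≡ 0 mod p` have no common solution in `(ℤ_p^×)^n`. -/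
def NonDeg (p : ℕ) [Fact p.Prime] {n : ℕ} (f : MvPolynomial (Fin n) ℤ_[p]) : Prop :=
  ∀ k ∈ orthant n, ¬ ∃ a : Fin n → ℤ_[p], (∀ i, IsUnit (a i)) ∧
    (p : ℤ_[p]) ∣ eval a (facePoly f k) ∧
    ∀ i, (p : ℤ_[p]) ∣ eval a (pderiv i (facePoly f k))

/-- The partition `D_{f,g}` of `ℝ_{≥0}^n`: the equivalence classes of
`k ∼ k' ↔ F_f(k) = F_f(k') ∧ F_g(k) = F_g(k')`. -/
noncomputable def Dfg {p n : ℕ} [Fact p.Prime] (f g : MvPolynomial (Fin n) ℤ_[p]) :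
    Set (Set (Fin n → ℝ)) :=
  {δ | ∃ k ∈ orthant n, δ = {k' ∈ orthant n |
    faceOf (newtonPoly f) k' = faceOf (newtonPoly f) k ∧
    faceOf (newtonPoly g) k' = faceOf (newtonPoly g) k}}

open Classical in
/-- For a cone `δ ∈ D_{f,g}`, the polynomial `f_δ = f_τ` where `τ` is the face of `Γ(f)`
associated to `δ` (computed from any point of `δ`; all points of a cone of `D_{f,g}`
give the same face). -/
noncomputable def conePoly {p n : ℕ} [Fact p.Prime] (f : MvPolynomial (Fin n) ℤ_[p])
    (δ : Set (Fin n → ℝ)) : MvPolynomial (Fin n) ℤ_[p] :=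
  if h : δ.Nonempty then facePoly f h.some else 0

/-- The pair `(f,g)` is non-degenerated over `𝔽_p` with respect to all the cones of
`D_{f,g}`: for each cone `δ`, the system `f_δ ≡ 0`, `g_δ ≡ 0` and all `2×2` minors of
the Jacobian of `(f_δ, g_δ)` `≡ 0 mod p` has no solution in `(ℤ_p^×)^n`. -/
def NonDegPair (p : ℕ) [Fact p.Prime] {n : ℕ} (f g : MvPolynomial (Fin n) ℤ_[p]) : Prop :=
  ∀ δ ∈ Dfg f g, ¬ ∃ a : Fin n → ℤ_[p], (∀ i, IsUnit (a i)) ∧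
    (p : ℤ_[p]) ∣ eval a (conePoly f δ) ∧
    (p : ℤ_[p]) ∣ eval a (conePoly g δ) ∧
    ∀ i j : Fin n, i < j → (p : ℤ_[p]) ∣ eval a
      (pderiv i (conePoly f δ) * pderiv j (conePoly g δ) -
       pderiv j (conePoly f δ) * pderiv i (conePoly g δ))

/-- `N_δ = #{a ∈ (𝔽_p^×)^n : f̄_δ(a) = 0 and ḡ_δ(a) ≠ 0}`. -/
noncomputable def Ndelta (p : ℕ) [Fact p.Prime] {n : ℕ} (f g : MvPolynomial (Fin n) ℤ_[p])
    (δ : Set (Fin n → ℝ)) : ℕ :=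
  Set.ncard {a : Fin n → ZMod p | (∀ i, a i ≠ 0) ∧
    eval a (redp (conePoly f δ)) = 0 ∧ eval a (redp (conePoly g δ)) ≠ 0}

/-- `P_δ = #{a ∈ (𝔽_p^×)^n : f̄_δ(a) ≠ 0 and ḡ_δ(a) = 0}`. -/
noncomputable def Pdelta (p : ℕ) [Fact p.Prime] {n : ℕ} (f g : MvPolynomial (Fin n) ℤ_[p])
    (δ : Set (Fin n → ℝ)) : ℕ :=
  Set.ncard {a : Fin n → ZMod p | (∀ i, a i ≠ 0) ∧
    eval a (redp (conePoly f δ)) ≠ 0 ∧ eval a (redp (conePoly g δ)) = 0}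

/-- `Q_δ = #{a ∈ (𝔽_p^×)^n : f̄_δ(a) = ḡ_δ(a) = 0}`. -/
noncomputable def Qdelta (p : ℕ) [Fact p.Prime] {n : ℕ} (f g : MvPolynomial (Fin n) ℤ_[p])
    (δ : Set (Fin n → ℝ)) : ℕ :=
  Set.ncard {a : Fin n → ZMod p | (∀ i, a i ≠ 0) ∧
    eval a (redp (conePoly f δ)) = 0 ∧ eval a (redp (conePoly g δ)) = 0}

/-- The factor `L_δ(s)`. -/
noncomputable def Ldelta (p : ℕ) [Fact p.Prime] {n : ℕ} (f g : MvPolynomial (Fin n) ℤ_[p])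
    (δ : Set (Fin n → ℝ)) (s : ℂ) : ℂ :=
  (p : ℂ) ^ (-(n : ℤ)) * (((p : ℂ) - 1) ^ n
    - (p : ℂ) * (Ndelta p f g δ) * ((p : ℂ) ^ s - 1) / ((p : ℂ) ^ (s + 1) - 1)
    - (Pdelta p f g δ) * (p : ℂ) / ((p : ℂ) + 1)
    - (p : ℂ) * (Qdelta p f g δ) * ((p : ℂ) ^ s * ((p : ℂ) + 1) - 2)
        / (((p : ℂ) ^ (s + 1) - 1) * ((p : ℂ) + 1)))

/-- The summand of the series `S_δ(s)` at a lattice point `k ∈ ℕ^n ∩ δ`. -/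
noncomputable def Sterm (p : ℕ) [Fact p.Prime] {n : ℕ} (f g : MvPolynomial (Fin n) ℤ_[p])
    (s : ℂ) (k : Fin n → ℕ) : ℂ :=
  (p : ℂ) ^ (-(mP (newtonPoly f) (toRn k) : ℂ) * s
    - (mP (newtonPoly g) (toRn k) : ℂ) - (sigmaFn k : ℂ))

/-- The series `S_δ(s) = Σ_{k ∈ ℕ^n ∩ δ} p^{-m_f(k)s - m_g(k) - σ(k)}`. -/
noncomputable def Sdelta (p : ℕ) [Fact p.Prime] {n : ℕ} (f g : MvPolynomial (Fin n) ℤ_[p])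
    (δ : Set (Fin n → ℝ)) (s : ℂ) : ℂ :=
  ∑' k : {k : Fin n → ℕ // toRn k ∈ δ}, Sterm p f g s k


section Part1
variable {p : ℕ} [Fact p.Prime] {n : ℕ}

instance padicHaar_inv : (padicHaar p n).IsAddHaarMeasure := by
  unfold padicHaar; infer_instance

instance padicHaar_prob : IsProbabilityMeasure (padicHaar p n) := by
  constructor
  have := Measure.addHaarMeasure_self (K₀ := (⟨⟨Set.univ, isCompact_univ⟩, by simp⟩ :
    TopologicalSpace.PositiveCompacts (Fin n → ℤ_[p])))
  simpa [padicHaar] using this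

theorem toZModPow_eq_iff (m : ℕ) (x y : ℤ_[p]) :
    PadicInt.toZModPow m x = PadicInt.toZModPow m y ↔ (p : ℤ_[p]) ^ m ∣ x - y := by
  rw [← sub_eq_zero, ← map_sub, ← RingHom.mem_ker, PadicInt.ker_toZModPow,
    Ideal.mem_span_singleton]

theorem toZMod_eq_iff (x y : ℤ_[p]) :
    PadicInt.toZMod x = PadicInt.toZMod y ↔ (p : ℤ_[p]) ∣ x - y := by
  rw [← sub_eq_zero, ← map_sub, ← RingHom.mem_ker, PadicInt.ker_toZMod,
    PadicInt.maximalIdeal_eq_span_p, Ideal.mem_span_singleton]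

theorem isOpen_dvd (m : ℕ) : IsOpen {x : ℤ_[p] | (p : ℤ_[p]) ^ m ∣ x} := by
  have : {x : ℤ_[p] | (p : ℤ_[p]) ^ m ∣ x} = Metric.closedBall 0 ((p : ℝ) ^ (-m : ℤ)) := by
    ext x
    simp only [Set.mem_ofPred_eq, mem_closedBall_zero_iff]
    rw [PadicInt.norm_le_pow_iff_mem_span_pow, Ideal.mem_span_singleton]
  rw [this]
  apply IsUltrametricDist.isOpen_closedBall
  have := (Fact.out : p.Prime).pos
  positivity

/-- reduction map -/
noncomputable def redk (k : Fin n → ℕ) : (Fin n → ℤ_[p]) →+ (∀ i, ZMod (p ^ (k i))) where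
  toFun x i := PadicInt.toZModPow (k i) (x i)
  map_zero' := by ext i; simp
  map_add' x y := by ext i; simp

theorem redk_eq_iff (k : Fin n → ℕ) (x y : Fin n → ℤ_[p]) :
    redk k x = redk k y ↔ ∀ i, (p : ℤ_[p]) ^ (k i) ∣ x i - y i := by
  simp only [← toZModPow_eq_iff, funext_iff]; rfl

theorem redk_surj (k : Fin n → ℕ) : Function.Surjective (redk (p := p) k) := by
  intro b
  choose x hx using fun i => ZMod.ringHom_surjective (PadicInt.toZModPow (p := p) (k i)) (b i)
  exact ⟨x, funext hx⟩

theorem isOpen_redk (k : Fin n → ℕ) (b : ∀ i, ZMod (p ^ (k i))) :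
    IsOpen (redk (p := p) k ⁻¹' {b}) := by
  obtain ⟨y, rfl⟩ := redk_surj (p := p) k b
  have : redk (p := p) k ⁻¹' {redk k y} = ⋂ i, (fun x => x i - y i) ⁻¹' {x : ℤ_[p] | (p : ℤ_[p]) ^ (k i) ∣ x} := by
    ext x; simp [redk_eq_iff]
  rw [this]
  exact isOpen_iInter_of_finite fun i => (isOpen_dvd _).preimage (by fun_prop)

theorem meas_redk (k : Fin n → ℕ) (b : ∀ i, ZMod (p ^ (k i))) :
    padicHaar p n (redk (p := p) k ⁻¹' {b}) = ((p : ENNReal) ^ (∑ i, k i))⁻¹ := by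
  have hpp := (Fact.out : p.Prime).pos
  have : ∀ i, NeZero (p ^ k i) := fun i => ⟨by positivity⟩
  have h1 : ∀ b, padicHaar p n (redk (p := p) k ⁻¹' {b}) = padicHaar p n (redk (p := p) k ⁻¹' {0}) := by
    intro b
    obtain ⟨y, hy⟩ := redk_surj (p := p) k b
    rw [← measure_preimage_add (padicHaar p n) y]
    congr 1
    ext x; simp [← hy]
  have h2 : ∑ b : (∀ i, ZMod (p ^ (k i))), padicHaar p n (redk (p := p) k ⁻¹' {b}) = 1 := by
    rw [← measure_biUnion_finset]
    · have : (⋃ b ∈ (Finset.univ : Finset (∀ i, ZMod (p ^ (k i)))), redk (p := p) k ⁻¹' {b}) = Set.univ := by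
        ext x; simp
      rw [this]; exact measure_univ
    · intro a _ b _ hab
      exact Set.disjoint_left.2 (fun x hx hx' => hab (hx.symm.trans hx'))
    · exact fun b _ => (isOpen_redk k b).measurableSet
  rw [h1 b]
  simp only [h1] at h2
  rw [Finset.sum_const, Finset.card_univ, Fintype.card_pi] at h2
  simp only [ZMod.card, nsmul_eq_mul] at h2
  rw [Finset.prod_pow_eq_pow_sum] at h2
  push_cast at h2
  exact ENNReal.eq_inv_of_mul_eq_one_left (by rwa [mul_comm])

/-- affine map -/
noncomputable def Taff (a : Fin n → ℤ_[p]) (k : Fin n → ℕ) (x : Fin n → ℤ_[p]) : Fin n → ℤ_[p] :=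
  fun i => a i + (p : ℤ_[p]) ^ (k i) * x i

theorem p_ne : (p : ℤ_[p]) ≠ 0 := by
  exact_mod_cast (Fact.out : p.Prime).ne_zero

theorem Taff_inj (a : Fin n → ℤ_[p]) (k : Fin n → ℕ) : Function.Injective (Taff a k) := by
  intro x y h
  ext1 i
  have := congrFun h i
  simp only [Taff, add_right_inj] at this
  exact mul_left_cancel₀ (pow_ne_zero _ p_ne) this

theorem Taff_emb (a : Fin n → ℤ_[p]) (k : Fin n → ℕ) : MeasurableEmbedding (Taff a k) := by
  have : Continuous (Taff a k) := by unfold Taff; fun_prop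
  exact (this.isClosedEmbedding (Taff_inj a k)).measurableEmbedding

theorem Taff_range (a : Fin n → ℤ_[p]) (k : Fin n → ℕ) :
    Set.range (Taff a k) = redk k ⁻¹' {redk k a} := by
  ext y
  simp only [Set.mem_range, Set.mem_preimage, Set.mem_singleton_iff, redk_eq_iff]
  constructor
  · rintro ⟨x, rfl⟩ i; simp [Taff]
  · intro h
    choose x hx using h
    refine ⟨x, funext fun i => ?_⟩
    simp [Taff, ← hx]

theorem Taff_comap (a : Fin n → ℤ_[p]) (k : Fin n → ℕ) :
    (padicHaar p n).comap (Taff a k) = ((p : ENNReal) ^ (∑ i, k i))⁻¹ • padicHaar p n := by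
  have hT := Taff_emb a k
  have hinv : ((padicHaar p n).comap (Taff a k)).IsAddLeftInvariant := by
    constructor
    intro v
    ext S hS
    have hS' : MeasurableSet ((fun x => v + x) ⁻¹' S) := (measurable_const_add v) hS
    rw [Measure.map_apply (measurable_const_add v) hS, hT.comap_apply, hT.comap_apply,
      ← measure_preimage_add (padicHaar p n) (fun i => (p : ℤ_[p]) ^ (k i) * v i) (Taff a k '' S)]
    congr 1
    ext y
    simp only [Set.mem_image, Set.mem_preimage]
    constructor
    · rintro ⟨x, hx, rfl⟩
      refine ⟨_, hx, ?_⟩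
      ext1 i; simp [Taff]; ring
    · rintro ⟨x, hx, hxy⟩
      refine ⟨x - v, by simpa using hx, ?_⟩
      ext1 i
      have := congrFun hxy i
      simp [Taff] at this ⊢
      linear_combination this
  have hfin : IsFiniteMeasure ((padicHaar p n).comap (Taff a k)) := by
    constructor
    rw [hT.comap_apply]; exact measure_lt_top _ _
  have key := Measure.isAddLeftInvariant_eq_smul ((padicHaar p n).comap (Taff a k)) (padicHaar p n)
  have h2 := congrArg (fun m : Measure (Fin n → ℤ_[p]) => m Set.univ) key
  simp only [Measure.smul_apply, measure_univ] at h2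
  rw [hT.comap_apply, Set.image_univ, Taff_range, meas_redk] at h2
  rw [key]
  ext S hS
  rw [Measure.smul_apply, Measure.smul_apply, h2, ENNReal.smul_def, ENNReal.smul_def, smul_eq_mul, smul_eq_mul, smul_eq_mul, mul_one]

theorem setIntegral_Taff (a : Fin n → ℤ_[p]) (k : Fin n → ℕ) (F : (Fin n → ℤ_[p]) → ℂ) :
    ∫ y in Set.range (Taff a k), F y ∂(padicHaar p n) =
      ((p : ℂ) ^ (∑ i, k i))⁻¹ * ∫ x, F (Taff a k x) ∂(padicHaar p n) := by
  have hT := Taff_emb a k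
  rw [← hT.map_comap, hT.integral_map, Taff_comap, integral_smul_measure]
  simp

theorem measurePreserving_of (Φ : (Fin n → ℤ_[p]) → (Fin n → ℤ_[p])) (hc : Continuous Φ)
    (h1 : ∀ (m : ℕ) x y, (∀ i, (p : ℤ_[p]) ^ m ∣ x i - y i) → ∀ i, (p : ℤ_[p]) ^ m ∣ Φ x i - Φ y i)
    (h2 : ∀ (m : ℕ) x y, (∀ i, (p : ℤ_[p]) ^ m ∣ x i - y i) →
      (∀ i, (p : ℤ_[p]) ^ (m + 1) ∣ Φ x i - Φ y i) → ∀ i, (p : ℤ_[p]) ^ (m + 1) ∣ x i - y i) :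
    MeasurePreserving Φ (padicHaar p n) (padicHaar p n) := by
  have hpp := (Fact.out : p.Prime).pos
  have h3 : ∀ (m : ℕ) x y, (∀ i, (p : ℤ_[p]) ^ m ∣ Φ x i - Φ y i) → ∀ i, (p : ℤ_[p]) ^ m ∣ x i - y i := by
    intro m
    induction m with
    | zero => intro x y _ i; simp
    | succ m ih =>
      intro x y h
      exact h2 m x y (ih x y fun i => (pow_dvd_pow _ (Nat.le_succ m)).trans (h i)) h
  refine ⟨hc.measurable, ?_⟩
  have hbasis : TopologicalSpace.IsTopologicalBasis
      {S : Set (Fin n → ℤ_[p]) | ∃ (m : ℕ) (b : _), S = redk (p := p) (fun _ : Fin n => m) ⁻¹' {b}} := by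
    apply TopologicalSpace.isTopologicalBasis_of_isOpen_of_nhds
    · rintro _ ⟨m, b, rfl⟩; exact isOpen_redk _ b
    · intro a u ha hu
      obtain ⟨ε, hε, hεu⟩ := Metric.isOpen_iff.1 hu a ha
      obtain ⟨m, hm⟩ := exists_pow_lt_of_lt_one hε (y := (p : ℝ)⁻¹)
        (inv_lt_one_of_one_lt₀ (by exact_mod_cast (Fact.out : p.Prime).one_lt))
      refine ⟨_, ⟨m, redk _ a, rfl⟩, rfl, fun y hy => hεu ?_⟩
      simp only [Set.mem_preimage, Set.mem_singleton_iff, redk_eq_iff] at hy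
      rw [Metric.mem_ball, dist_pi_lt_iff hε]
      intro i
      refine lt_of_le_of_lt ?_ hm
      rw [dist_eq_norm, inv_pow, ← zpow_natCast, ← zpow_neg, PadicInt.norm_le_pow_iff_mem_span_pow, Ideal.mem_span_singleton]
      exact hy i
  have hprob : IsProbabilityMeasure ((padicHaar p n).map Φ) :=
    Measure.isProbabilityMeasure_map hc.measurable.aemeasurable
  refine ext_of_generate_finite _
    ((BorelSpace.measurable_eq).trans hbasis.borel_eq_generateFrom) ?_ ?_ (by simp)
  · rintro S hS S' hS' ⟨z, hz, hz'⟩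
    obtain ⟨m, b, rfl⟩ := hS
    obtain ⟨m', b', rfl⟩ := hS'
    have hz1 : redk _ z = b := hz
    have hz2 : redk _ z = b' := hz'
    subst hz1 hz2
    refine ⟨max m m', redk _ z, ?_⟩
    ext y
    simp only [Set.mem_inter_iff, Set.mem_preimage, Set.mem_singleton_iff, redk_eq_iff]
    constructor
    · rintro ⟨h, h'⟩ i
      rcases max_choice m m' with h0 | h0 <;> rw [h0]
      · exact h i
      · exact h' i
    · intro h
      exact ⟨fun i => (pow_dvd_pow _ (le_max_left _ _)).trans (h i),
        fun i => (pow_dvd_pow _ (le_max_right _ _)).trans (h i)⟩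
  · rintro S ⟨m, b, rfl⟩
    rw [Measure.map_apply hc.measurable (isOpen_redk _ b).measurableSet, meas_redk]
    have : NeZero (p ^ m) := ⟨by positivity⟩
    -- induced map is bijective
    let sec : (Fin n → ZMod (p ^ m)) → (Fin n → ℤ_[p]) := Function.surjInv (redk_surj (p := p) (fun _ : Fin n => m))
    have hsec : ∀ b, redk (fun _ : Fin n => m) (sec b) = b := Function.surjInv_eq _
    let φ : (Fin n → ZMod (p ^ m)) → (Fin n → ZMod (p ^ m)) := fun b => redk (fun _ => m) (Φ (sec b))
    have hφ : Function.Injective φ := by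
      intro b b' h
      rw [← hsec b, ← hsec b', redk_eq_iff]
      exact h3 m _ _ ((redk_eq_iff _ _ _).1 h)
    obtain ⟨c, hc'⟩ := Finite.surjective_of_injective hφ b
    have : Φ ⁻¹' (redk (p := p) (fun _ : Fin n => m) ⁻¹' {b}) = redk (p := p) (fun _ : Fin n => m) ⁻¹' {c} := by
      ext x
      simp only [Set.mem_preimage, Set.mem_singleton_iff]
      have e1 : redk (fun _ : Fin n => m) (Φ x) = b ↔ ∀ i, (p : ℤ_[p]) ^ m ∣ Φ x i - Φ (sec c) i := by rw [← hc']; exact redk_eq_iff _ _ _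
      have e2 : redk (fun _ : Fin n => m) x = c ↔ ∀ i, (p : ℤ_[p]) ^ m ∣ x i - sec c i := by
        conv_lhs => rw [← hsec c]
        exact redk_eq_iff _ _ _
      rw [e1, e2]
      exact ⟨h3 m _ _, h1 m _ _⟩
    rw [this, meas_redk]

end Part1


section Part2
variable {p : ℕ} [Fact p.Prime] {n : ℕ}

theorem eval_dvd (h : MvPolynomial (Fin n) ℤ_[p]) (c : ℤ_[p]) (X Y : Fin n → ℤ_[p])
    (hXY : ∀ i, c ∣ X i - Y i) : c ∣ eval X h - eval Y h := by
  induction h using MvPolynomial.induction_on with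
  | C a => simp
  | add f g hf hg =>
    simp only [map_add]
    convert dvd_add hf hg using 1; ring
  | mul_X f i hf =>
    simp only [map_mul, eval_X]
    convert dvd_add (hf.mul_right (X i)) ((hXY i).mul_left (eval Y f)) using 1; ring

theorem taylor_dvd (h : MvPolynomial (Fin n) ℤ_[p]) (a X Y : Fin n → ℤ_[p]) (m : ℕ)
    (hX : ∀ i, (p : ℤ_[p]) ∣ X i - a i) (hY : ∀ i, (p : ℤ_[p]) ∣ Y i - a i)
    (hXY : ∀ i, (p : ℤ_[p]) ^ (m + 1) ∣ X i - Y i) :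
    (p : ℤ_[p]) ^ (m + 2) ∣ eval X h - eval Y h - ∑ l, eval a (pderiv l h) * (X l - Y l) := by
  induction h using MvPolynomial.induction_on with
  | C a => simp
  | add f g hf hg =>
    simp only [map_add, add_mul, Finset.sum_add_distrib]
    convert dvd_add hf hg using 1; ring
  | mul_X f i hf =>
    have e : ∑ l, eval a (pderiv l (f * MvPolynomial.X i)) * (X l - Y l) =
        (∑ l, eval a (pderiv l f) * (X l - Y l)) * a i + eval a f * (X i - Y i) := by
      have : ∀ l, eval a (pderiv l (f * MvPolynomial.X i)) * (X l - Y l) =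
        eval a (pderiv l f) * (X l - Y l) * a i + if l = i then eval a f * (X i - Y i) else 0 := by
        intro l
        rw [pderiv_mul, pderiv_X]
        by_cases hl : l = i
        · subst hl; simp; ring
        · simp [Ne.symm hl, hl]; ring
      simp only [this, Finset.sum_add_distrib, Finset.sum_mul]
      simp
    rw [e]
    simp only [map_mul, eval_X]
    have h1 := (hf.mul_right (a i))
    have h2 : (p : ℤ_[p]) ^ (m + 2) ∣ (eval X f - eval Y f) * (X i - a i) := by
      rw [pow_succ]; exact mul_dvd_mul (eval_dvd f _ X Y hXY) (hX i)
    have h3 : (p : ℤ_[p]) ^ (m + 2) ∣ (eval Y f - eval a f) * (X i - Y i) := by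
      rw [pow_succ, mul_comm (_ ^ _)]; exact mul_dvd_mul (eval_dvd f _ Y a hY) (hXY i)
    convert dvd_add (dvd_add h1 h2) h3 using 1; ring

theorem continuous_eval' (H : MvPolynomial (Fin n) ℤ_[p]) : Continuous fun x : Fin n → ℤ_[p] => eval x H :=
  MvPolynomial.continuous_eval H

theorem exists_phi (H : MvPolynomial (Fin n) ℤ_[p]) (a : Fin n → ℤ_[p]) (hH : (p : ℤ_[p]) ∣ eval a H) :
    ∃ φ : (Fin n → ℤ_[p]) → ℤ_[p], Continuous φ ∧
      (∀ x, eval (fun i => a i + p * x i) H = p * φ x) ∧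
      ∀ (m : ℕ) x y, (∀ i, (p : ℤ_[p]) ^ m ∣ x i - y i) →
        (p : ℤ_[p]) ^ (m + 1) ∣ φ x - φ y - ∑ l, eval a (pderiv l H) * (x l - y l) := by
  have h1 : ∀ x : Fin n → ℤ_[p], (p : ℤ_[p]) ∣ eval (fun i => a i + p * x i) H := by
    intro x
    have := eval_dvd H (p : ℤ_[p]) (fun i => a i + p * x i) a (by intro i; simp)
    exact (dvd_sub_left hH).1 this
  choose φ hφ using h1
  refine ⟨φ, ?_, hφ, ?_⟩
  · have hc : Continuous fun x : ℤ_[p] => (p : ℤ_[p]) * x := by fun_prop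
    have hce := hc.isClosedEmbedding (fun x y h => mul_left_cancel₀ p_ne h)
    rw [hce.isInducing.continuous_iff]
    have : ((fun x : ℤ_[p] => (p : ℤ_[p]) * x) ∘ φ) = fun x => eval (fun i => a i + p * x i) H := by
      ext1 x; simp [hφ]
    rw [this]
    exact (continuous_eval' H).comp (by fun_prop)
  · intro m x y hxy
    have := taylor_dvd H a (fun i => a i + p * x i) (fun i => a i + p * y i) m (by simp) (by simp)
      (by intro i; simp only [add_sub_add_left_eq_sub, ← mul_sub]; rw [pow_succ']
          exact mul_dvd_mul_left _ (hxy i))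
    rw [hφ, hφ] at this
    have e : (p : ℤ_[p]) * φ x - p * φ y - ∑ l, eval a (pderiv l H) * ((a l + p * x l) - (a l + p * y l))
       = p * (φ x - φ y - ∑ l, eval a (pderiv l H) * (x l - y l)) := by
      simp only [mul_sub, Finset.mul_sum, add_sub_add_left_eq_sub, Finset.sum_sub_distrib]
      congr 2 <;> exact Finset.sum_congr rfl fun l _ => by ring
    rw [e, pow_succ' _ (m + 1)] at this
    exact (mul_dvd_mul_iff_left p_ne).1 this

theorem norm_p_mul (z : ℤ_[p]) : ‖(p : ℤ_[p]) * z‖ = (p : ℝ)⁻¹ * ‖z‖ := by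
  rw [norm_mul, PadicInt.norm_p]

theorem norm_eq_one_of_not_dvd {z : ℤ_[p]} (h : ¬ (p : ℤ_[p]) ∣ z) : ‖z‖ = 1 := by
  rw [← PadicInt.norm_lt_one_iff_dvd] at h
  exact le_antisymm (PadicInt.norm_le_one z) (not_lt.1 h)

theorem p_prime : Prime (p : ℤ_[p]) := PadicInt.prime_p

theorem mp_one (φ : (Fin n → ℤ_[p]) → ℤ_[p]) (hc : Continuous φ) (D : Fin n → ℤ_[p]) (i : Fin n)
    (hi : ¬ (p : ℤ_[p]) ∣ D i)
    (hφ : ∀ (m : ℕ) x y, (∀ i, (p : ℤ_[p]) ^ m ∣ x i - y i) →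
        (p : ℤ_[p]) ^ (m + 1) ∣ φ x - φ y - ∑ l, D l * (x l - y l)) :
    MeasurePreserving (fun x => Function.update x i (φ x)) (padicHaar p n) (padicHaar p n) := by
  apply measurePreserving_of
  · exact continuous_id.update i hc
  · intro m x y h l
    by_cases hl : l = i
    · subst hl
      simp only [Function.update_self]
      have h1 := (pow_dvd_pow _ (Nat.le_succ m)).trans (hφ m x y h)
      exact (dvd_sub_left (Finset.dvd_sum fun l _ => (h l).mul_left _)).1 h1
    · simpa [hl] using h l
  · intro m x y h h'
    have hne : ∀ l, l ≠ i → (p : ℤ_[p]) ^ (m + 1) ∣ x l - y l := fun l hl => by simpa [hl] using h' l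
    have hii := h' i
    simp only [Function.update_self] at hii
    have h1 := (dvd_sub_right hii).1 (hφ m x y h)
    rw [← Finset.add_sum_erase _ _ (Finset.mem_univ i)] at h1
    have h2 := (dvd_add_left (Finset.dvd_sum fun l hl => (hne l (Finset.ne_of_mem_erase hl)).mul_left _)).1 h1
    have h3 := p_prime.pow_dvd_of_dvd_mul_left _ hi h2
    intro l
    by_cases hl : l = i
    · subst hl; exact h3
    · exact hne l hl

theorem mp_two (φ γ : (Fin n → ℤ_[p]) → ℤ_[p]) (hc : Continuous φ) (hc' : Continuous γ)
    (D D' : Fin n → ℤ_[p]) (i j : Fin n) (hij : i ≠ j)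
    (hi : ¬ (p : ℤ_[p]) ∣ D i * D' j - D j * D' i)
    (hφ : ∀ (m : ℕ) x y, (∀ i, (p : ℤ_[p]) ^ m ∣ x i - y i) →
        (p : ℤ_[p]) ^ (m + 1) ∣ φ x - φ y - ∑ l, D l * (x l - y l))
    (hγ : ∀ (m : ℕ) x y, (∀ i, (p : ℤ_[p]) ^ m ∣ x i - y i) →
        (p : ℤ_[p]) ^ (m + 1) ∣ γ x - γ y - ∑ l, D' l * (x l - y l)) :
    MeasurePreserving (fun x => Function.update (Function.update x i (φ x)) j (γ x))
      (padicHaar p n) (padicHaar p n) := by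
  apply measurePreserving_of
  · exact (continuous_id.update i hc).update j hc'
  · intro m x y h l
    by_cases hlj : l = j
    · subst hlj
      simp only [Function.update_self]
      have h1 := (pow_dvd_pow _ (Nat.le_succ m)).trans (hγ m x y h)
      exact (dvd_sub_left (Finset.dvd_sum fun l _ => (h l).mul_left _)).1 h1
    by_cases hl : l = i
    · subst hl
      simp only [Function.update_self, Function.update_of_ne hlj]
      have h1 := (pow_dvd_pow _ (Nat.le_succ m)).trans (hφ m x y h)
      exact (dvd_sub_left (Finset.dvd_sum fun l _ => (h l).mul_left _)).1 h1
    · simpa [hl, hlj] using h l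
  · intro m x y h h'
    have hne : ∀ l, l ≠ i → l ≠ j → (p : ℤ_[p]) ^ (m + 1) ∣ x l - y l :=
      fun l hl hlj => by simpa [hl, hlj] using h' l
    have hii := h' i
    have hjj := h' j
    simp only [Function.update_self, Function.update_of_ne hij] at hii hjj
    have key : ∀ E : Fin n → ℤ_[p], (p : ℤ_[p]) ^ (m + 1) ∣ ∑ l, E l * (x l - y l) →
        (p : ℤ_[p]) ^ (m + 1) ∣ E i * (x i - y i) + E j * (x j - y j) := by
      intro E h1
      rw [← Finset.add_sum_erase _ _ (Finset.mem_univ i),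
        ← Finset.add_sum_erase _ _ (Finset.mem_erase.2 ⟨hij.symm, Finset.mem_univ j⟩), ← add_assoc] at h1
      refine (dvd_add_left (Finset.dvd_sum fun l hl => (hne l ?_ ?_).mul_left _)).1 h1
      · exact Finset.ne_of_mem_erase (Finset.mem_of_mem_erase hl)
      · exact Finset.ne_of_mem_erase hl
    have h1 := key _ ((dvd_sub_right hii).1 (hφ m x y h))
    have h2 := key _ ((dvd_sub_right hjj).1 (hγ m x y h))
    have h3 : (p : ℤ_[p]) ^ (m + 1) ∣ x i - y i := by
      apply p_prime.pow_dvd_of_dvd_mul_left _ hi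
      convert dvd_sub (h1.mul_left (D' j)) (h2.mul_left (D j)) using 1; ring
    have h4 : (p : ℤ_[p]) ^ (m + 1) ∣ x j - y j := by
      apply p_prime.pow_dvd_of_dvd_mul_left _ hi
      convert dvd_sub (h2.mul_left (D i)) (h1.mul_left (D' i)) using 1; ring
    intro l
    by_cases hl : l = i
    · subst hl; exact h3
    by_cases hlj : l = j
    · subst hlj; exact h4
    · exact hne l hl hlj

end Part2


section Part3
variable {p : ℕ} [Fact p.Prime] {n : ℕ}

theorem intble {F : (Fin n → ℤ_[p]) → ℂ} (hF : Continuous F) : Integrable F (padicHaar p n) :=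
  hF.integrable_of_hasCompactSupport (HasCompactSupport.of_compactSpace F)

theorem cont_cpow {s : ℂ} (hs : 0 < s.re) {φ : (Fin n → ℤ_[p]) → ℤ_[p]} (hφ : Continuous φ) :
    Continuous fun x => ((‖φ x‖ : ℝ) : ℂ) ^ s :=
  (Complex.continuous_ofReal_cpow_const hs).comp hφ.norm

theorem pC_ne : (p : ℂ) ≠ 0 := by
  exact_mod_cast (Fact.out : p.Prime).ne_zero

theorem ps_ne_zero (s : ℂ) : (p : ℂ) ^ s ≠ 0 := by
  rw [Complex.cpow_def_of_ne_zero pC_ne]; exact Complex.exp_ne_zero _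

theorem ps_ne_one {s : ℂ} (hs : 0 < s.re) : (p : ℂ) ^ (s + 1) - 1 ≠ 0 := by
  intro h
  have h1 := congrArg norm (sub_eq_zero.1 h)
  rw [Complex.norm_natCast_cpow_of_pos (Fact.out : p.Prime).pos] at h1
  have h2 : (1 : ℝ) < (p : ℝ) ^ ((s + 1).re) :=
    Real.one_lt_rpow (by exact_mod_cast (Fact.out : p.Prime).one_lt) (by simp; linarith)
  simp at h1 h2
  linarith

theorem norm_p_mul_cpow (z : ℤ_[p]) (s : ℂ) :
    ((‖(p : ℤ_[p]) * z‖ : ℝ) : ℂ) ^ s = ((p : ℂ) ^ s)⁻¹ * ((‖z‖ : ℝ) : ℂ) ^ s := by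
  rw [norm_p_mul, Complex.ofReal_mul, Complex.mul_cpow_ofReal_nonneg (by positivity) (norm_nonneg _)]
  congr 1
  rw [Complex.ofReal_inv, Complex.ofReal_natCast, Complex.inv_cpow]
  rw [Complex.natCast_arg]; exact Real.pi_pos.ne

theorem self_sim {s : ℂ} (hs : 0 < s.re) (i : Fin n) (G : (Fin n → ℤ_[p]) → ℂ) (hG : Continuous G)
    (hGi : ∀ x, G (Taff 0 (Pi.single i 1) x) = G x) :
    ((p : ℂ) ^ s)⁻¹ * ∫ x, ((‖x i‖ : ℝ) : ℂ) ^ s * G x ∂(padicHaar p n) =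
      ((p : ℂ) - 1) / ((p : ℂ) ^ (s + 1) - 1) * ∫ x, G x ∂(padicHaar p n) := by
  set R := Set.range (Taff (p := p) (n := n) 0 (Pi.single i 1)) with hR
  have hRm : MeasurableSet R := (Taff_emb _ _).measurableSet_range
  have hcF : Continuous fun x : Fin n → ℤ_[p] => ((‖x i‖ : ℝ) : ℂ) ^ s * G x :=
    (cont_cpow hs (continuous_apply i)).mul hG
  have hsum : ∑ j, (Pi.single i 1 : Fin n → ℕ) j = 1 := by simp
  have e1 := integral_add_compl hRm (intble hcF)
  have e2 := integral_add_compl hRm (intble hG)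
  have e3 : ∫ x in Rᶜ, ((‖x i‖ : ℝ) : ℂ) ^ s * G x ∂(padicHaar p n) = ∫ x in Rᶜ, G x ∂(padicHaar p n) := by
    apply setIntegral_congr_fun hRm.compl
    intro x hx
    have : ¬ (p : ℤ_[p]) ∣ x i := by
      rintro ⟨z, hz⟩
      apply hx
      refine ⟨Function.update x i z, ?_⟩
      ext1 j
      by_cases hj : j = i
      · subst hj; simp [Taff, hz]
      · simp [Taff, hj]
    simp [norm_eq_one_of_not_dvd this]
  have e4 : ∫ x in R, ((‖x i‖ : ℝ) : ℂ) ^ s * G x ∂(padicHaar p n) =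
      (p : ℂ)⁻¹ * (((p : ℂ) ^ s)⁻¹ * ∫ x, ((‖x i‖ : ℝ) : ℂ) ^ s * G x ∂(padicHaar p n)) := by
    rw [hR, setIntegral_Taff, hsum, pow_one]
    congr 1
    rw [← integral_const_mul]
    apply integral_congr_ae
    refine Filter.Eventually.of_forall fun x => ?_
    simp only [hGi]
    rw [← mul_assoc, ← norm_p_mul_cpow]
    simp [Taff]
  have e5 : ∫ x in R, G x ∂(padicHaar p n) = (p : ℂ)⁻¹ * ∫ x, G x ∂(padicHaar p n) := by
    rw [hR, setIntegral_Taff, hsum, pow_one]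
    simp only [hGi]
  rw [e4, e3] at e1
  rw [e5] at e2
  generalize (∫ x, ((‖x i‖ : ℝ) : ℂ) ^ s * G x ∂(padicHaar p n)) = I at *
  generalize (∫ x, G x ∂(padicHaar p n)) = K at *
  have hp := pC_ne (p := p)
  have hq := ps_ne_zero (p := p) s
  have h1 := ps_ne_one (p := p) hs
  rw [Complex.cpow_add _ _ hp, Complex.cpow_one] at *
  generalize (p : ℂ) ^ s = q at *
  generalize (p : ℂ) = P at *
  have e6 : (∫ x in Rᶜ, G x ∂(padicHaar p n)) = K - P⁻¹ * K := by linear_combination e2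
  rw [e6] at e1
  rw [div_mul_eq_mul_div, eq_div_iff h1]
  field_simp at e1 ⊢
  linear_combination -e1

theorem integral_mp {Φ : (Fin n → ℤ_[p]) → (Fin n → ℤ_[p])}
    (h : MeasurePreserving Φ (padicHaar p n) (padicHaar p n)) {F : (Fin n → ℤ_[p]) → ℂ} (hF : Continuous F) :
    ∫ x, F (Φ x) ∂(padicHaar p n) = ∫ x, F x ∂(padicHaar p n) := by
  conv_rhs => rw [← h.map_eq]
  rw [integral_map h.measurable.aemeasurable]
  rw [h.map_eq]; exact (intble hF).aestronglyMeasurable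

theorem norm_unit (H : MvPolynomial (Fin n) ℤ_[p]) (a : Fin n → ℤ_[p]) (h : ¬ (p : ℤ_[p]) ∣ eval a H)
    (x : Fin n → ℤ_[p]) : ‖eval (fun i => a i + p * x i) H‖ = 1 := by
  apply norm_eq_one_of_not_dvd
  intro h'
  apply h
  have := eval_dvd H (p : ℤ_[p]) (fun i => a i + p * x i) a (by intro i; simp)
  exact (dvd_sub_right h').1 this

theorem loc_one {s : ℂ} (hs : 0 < s.re) (H : MvPolynomial (Fin n) ℤ_[p]) (a : Fin n → ℤ_[p])
    (h : (p : ℤ_[p]) ∣ eval a H) (h' : ∃ i, ¬ (p : ℤ_[p]) ∣ eval a (pderiv i H)) :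
    ∫ x : Fin n → ℤ_[p], ((‖eval (fun i => a i + p * x i) H‖ : ℝ) : ℂ) ^ s ∂(padicHaar p n) =
      ((p : ℂ) - 1) / ((p : ℂ) ^ (s + 1) - 1) := by
  obtain ⟨i, hi⟩ := h'
  obtain ⟨φ, hc, h1, h2⟩ := exists_phi H a h
  have hmp := mp_one φ hc _ i hi h2
  have h3 := integral_mp hmp (cont_cpow hs (continuous_apply i))
  simp only [Function.update_self] at h3
  simp only [h1, norm_p_mul_cpow]
  rw [integral_const_mul, h3]
  have := self_sim (p := p) hs i (fun _ => 1) continuous_const (fun _ => rfl)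
  simpa using this

open Classical in
theorem loc_two {s t : ℂ} (hs : 0 < s.re) (ht : 0 < t.re) (H H' : MvPolynomial (Fin n) ℤ_[p])
    (a : Fin n → ℤ_[p])
    (h : (p : ℤ_[p]) ∣ eval a H → ∃ i, ¬ (p : ℤ_[p]) ∣ eval a (pderiv i H))
    (h' : (p : ℤ_[p]) ∣ eval a H' → ∃ i, ¬ (p : ℤ_[p]) ∣ eval a (pderiv i H'))
    (hh' : (p : ℤ_[p]) ∣ eval a H → (p : ℤ_[p]) ∣ eval a H' → ∃ i j, i < j ∧
      ¬ (p : ℤ_[p]) ∣ eval a (pderiv i H) * eval a (pderiv j H') - eval a (pderiv j H) * eval a (pderiv i H')) :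
    ∫ x : Fin n → ℤ_[p], ((‖eval (fun i => a i + p * x i) H‖ : ℝ) : ℂ) ^ s *
      ((‖eval (fun i => a i + p * x i) H'‖ : ℝ) : ℂ) ^ t ∂(padicHaar p n) =
      (if (p : ℤ_[p]) ∣ eval a H then ((p : ℂ) - 1) / ((p : ℂ) ^ (s + 1) - 1) else 1) *
      (if (p : ℤ_[p]) ∣ eval a H' then ((p : ℂ) - 1) / ((p : ℂ) ^ (t + 1) - 1) else 1) := by
  by_cases d : (p : ℤ_[p]) ∣ eval a H <;> by_cases d' : (p : ℤ_[p]) ∣ eval a H'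
  · rw [if_pos d, if_pos d']
    obtain ⟨i, j, hij, hd⟩ := hh' d d'
    obtain ⟨φ, hc, h1, h2⟩ := exists_phi H a d
    obtain ⟨γ, hc', h1', h2'⟩ := exists_phi H' a d'
    have hmp := mp_two φ γ hc hc' _ _ i j hij.ne hd h2 h2'
    have h3 := integral_mp (F := fun x => ((‖x i‖ : ℝ) : ℂ) ^ s * ((‖x j‖ : ℝ) : ℂ) ^ t) hmp ((cont_cpow hs (continuous_apply i)).mul (cont_cpow ht (continuous_apply j)))
    simp only [Function.update_self, Function.update_of_ne hij.ne] at h3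
    simp only [h1, h1', norm_p_mul_cpow]
    have e : ∀ x, ((p : ℂ) ^ s)⁻¹ * (‖φ x‖ : ℂ) ^ s * (((p : ℂ) ^ t)⁻¹ * (‖γ x‖ : ℂ) ^ t) =
      ((p : ℂ) ^ s)⁻¹ * ((p : ℂ) ^ t)⁻¹ * ((‖φ x‖ : ℂ) ^ s * (‖γ x‖ : ℂ) ^ t) := fun x => by ring
    simp only [e]
    rw [integral_const_mul, h3]
    have e1 := self_sim (p := p) hs i (fun x => ((‖x j‖ : ℝ) : ℂ) ^ t) (cont_cpow ht (continuous_apply j))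
      (fun x => by simp [Taff, hij.ne'])
    have e2 := self_sim (p := p) ht j (fun _ => 1) continuous_const (fun _ => rfl)
    simp at e2
    rw [mul_assoc, mul_left_comm, e1, mul_left_comm, e2]
  · rw [if_pos d, if_neg d']
    simp only [norm_unit H' a d', Complex.ofReal_one, Complex.one_cpow, mul_one]
    exact loc_one hs H a d (h d)
  · rw [if_neg d, if_pos d']
    simp only [norm_unit H a d, Complex.ofReal_one, Complex.one_cpow, one_mul]
    exact loc_one ht H' a d' (h' d')
  · rw [if_neg d, if_neg d']
    simp [norm_unit H a d, norm_unit H' a d']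

end Part3


section Part4
variable {p : ℕ} [Fact p.Prime] {n : ℕ}

theorem toR_mem (f : MvPolynomial (Fin n) ℤ_[p]) {ω : Fin n →₀ ℕ} (hω : ω ∈ f.support) :
    toR ω ∈ newtonPoly f := by
  apply subset_convexHull
  simp only [Set.mem_iUnion]
  exact ⟨ω, hω, 0, fun i => le_rfl, by simp⟩

theorem dot_gen_le {k : Fin n → ℝ} (hk : k ∈ orthant n) (w c : Fin n → ℝ) (hc : c ∈ orthant n) :
    ∑ i, k i * w i ≤ ∑ i, k i * (w + c) i := by
  apply Finset.sum_le_sum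
  intro i _
  have := mul_nonneg (hk i) (hc i)
  simp only [Pi.add_apply, mul_add]; linarith

theorem mP_spec (f : MvPolynomial (Fin n) ℤ_[p]) (hf : f ≠ 0) {k : Fin n → ℝ} (hk : k ∈ orthant n) :
    (∃ ω ∈ f.support, mP (newtonPoly f) k = ∑ i, k i * toR ω i) ∧
    ∀ x ∈ newtonPoly f, mP (newtonPoly f) k ≤ ∑ i, k i * x i := by
  obtain ⟨ω, hω, hmin⟩ := Finset.exists_min_image f.support (fun ω => ∑ i, k i * toR ω i)
    (Finset.nonempty_iff_ne_empty.2 (by simpa using hf))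
  have h1 : ∀ x ∈ newtonPoly f, ∑ i, k i * toR ω i ≤ ∑ i, k i * x i := by
    have hsub : newtonPoly f ⊆ {x | ∑ i, k i * toR ω i ≤ ∑ i, k i * x i} := by
      apply convexHull_min
      · intro x hx
        simp only [Set.mem_iUnion] at hx
        obtain ⟨ω', hω', c, hc, rfl⟩ := hx
        exact (hmin ω' hω').trans (dot_gen_le hk _ c hc)
      · apply convex_halfSpace_ge
        exact ⟨fun x y => by simp [mul_add, Finset.sum_add_distrib],
          fun c x => by simp [Finset.mul_sum, mul_left_comm]⟩
    exact fun x hx => hsub hx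
  have h2 : mP (newtonPoly f) k = ∑ i, k i * toR ω i := by
    apply IsLeast.csInf_eq
    refine ⟨⟨_, toR_mem f hω, rfl⟩, ?_⟩
    rintro _ ⟨x, hx, rfl⟩
    exact h1 x hx
  exact ⟨⟨ω, hω, h2⟩, fun x hx => h2 ▸ h1 x hx⟩

theorem face_subset (f : MvPolynomial (Fin n) ℤ_[p]) (hf : f ≠ 0) {k k' : Fin n → ℝ}
    (hk : k ∈ orthant n) (hk' : k' ∈ orthant n)
    (h1 : ∀ ω ∈ f.support, ∑ i, k i * toR ω i = mP (newtonPoly f) k →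
      ∑ i, k' i * toR ω i = mP (newtonPoly f) k')
    (h2 : ∀ i, k i = 0 → k' i = 0) : faceOf (newtonPoly f) k ⊆ faceOf (newtonPoly f) k' := by
  rintro x ⟨hx, hxm⟩
  refine ⟨hx, ?_⟩
  obtain ⟨-, hge⟩ := mP_spec f hf hk
  obtain ⟨ι, _, w, z, hw, hw1, hz, hxz⟩ := mem_convexHull_iff_exists_fintype.1 hx
  have hdot : ∀ κ : Fin n → ℝ, ∑ i, κ i * x i = ∑ j, w j * ∑ i, κ i * z j i := by
    intro κ
    simp only [← hxz, Finset.sum_apply, Pi.smul_apply, smul_eq_mul, Finset.mul_sum]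
    rw [Finset.sum_comm]
    exact Finset.sum_congr rfl fun j _ => Finset.sum_congr rfl fun i _ => by ring
  have hz' : ∀ j, z j ∈ newtonPoly f := fun j => subset_convexHull _ _ (hz j)
  have hnn : ∀ j ∈ Finset.univ, 0 ≤ w j * (∑ i, k i * z j i - mP (newtonPoly f) k) :=
    fun j _ => mul_nonneg (hw j) (sub_nonneg.2 (hge _ (hz' j)))
  have hs0 : ∑ j, w j * (∑ i, k i * z j i - mP (newtonPoly f) k) = 0 := by
    simp only [mul_sub, Finset.sum_sub_distrib, ← Finset.sum_mul, hw1, ← hdot, hxm]; ring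
  rw [Finset.sum_eq_zero_iff_of_nonneg hnn] at hs0
  have key : ∀ j, w j * ∑ i, k' i * z j i = w j * mP (newtonPoly f) k' := by
    intro j
    rcases mul_eq_zero.1 (hs0 j (Finset.mem_univ j)) with h0 | h0
    · simp [h0]
    congr 1
    have hzj := hz j
    simp only [Set.mem_iUnion] at hzj
    obtain ⟨ω, hω, c, hc, hzc⟩ := hzj
    rw [← hzc] at h0 ⊢
    have hωm := hge _ (toR_mem f hω)
    simp only [Pi.add_apply, mul_add, Finset.sum_add_distrib] at h0 ⊢
    have hcn : ∀ i ∈ Finset.univ, 0 ≤ k i * c i := fun i _ => mul_nonneg (hk i) (hc i)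
    have hcs := Finset.sum_nonneg hcn
    have hc0 : ∑ i, k i * c i = 0 := by linarith
    rw [h1 ω hω (by linarith)]
    rw [Finset.sum_eq_zero_iff_of_nonneg hcn] at hc0
    have : ∑ i, k' i * c i = 0 := Finset.sum_eq_zero fun i hi => by
      rcases mul_eq_zero.1 (hc0 i hi) with h | h
      · simp [h2 i h]
      · simp [h]
    linarith
  rw [hdot]
  simp only [key, ← Finset.sum_mul, hw1, one_mul]

theorem Dfg_finite (f g : MvPolynomial (Fin n) ℤ_[p]) (hf : f ≠ 0) (hg : g ≠ 0) : (Dfg f g).Finite := by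
  let key : orthant n → ({ω // ω ∈ f.support} → Prop) × ({ω // ω ∈ g.support} → Prop) × (Fin n → Prop) :=
    fun k => (fun ω => ∑ i, k.1 i * toR ω.1 i = mP (newtonPoly f) k.1,
      fun ω => ∑ i, k.1 i * toR ω.1 i = mP (newtonPoly g) k.1, fun i => k.1 i = 0)
  let d : orthant n → Set (Fin n → ℝ) := fun k => {k' ∈ orthant n |
    faceOf (newtonPoly f) k' = faceOf (newtonPoly f) k ∧
    faceOf (newtonPoly g) k' = faceOf (newtonPoly g) k}
  have hd : Function.FactorsThrough d key := by
    intro k k' h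
    simp only [key, Prod.mk.injEq, funext_iff, Subtype.forall, eq_iff_iff] at h
    obtain ⟨hA, hB, hC⟩ := h
    have e1 : faceOf (newtonPoly f) k.1 = faceOf (newtonPoly f) k'.1 :=
      (face_subset f hf k.2 k'.2 (fun ω h => (hA ω h).1) (fun i => (hC i).1)).antisymm
        (face_subset f hf k'.2 k.2 (fun ω h => (hA ω h).2) (fun i => (hC i).2))
    have e2 : faceOf (newtonPoly g) k.1 = faceOf (newtonPoly g) k'.1 :=
      (face_subset g hg k.2 k'.2 (fun ω h => (hB ω h).1) (fun i => (hC i).1)).antisymm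
        (face_subset g hg k'.2 k.2 (fun ω h => (hB ω h).2) (fun i => (hC i).2))
    simp only [d, e1, e2]
  obtain ⟨e, he⟩ := (Function.factorsThrough_iff d).1 hd
  refine (Set.finite_range e).subset ?_
  rintro δ ⟨k, hk, rfl⟩
  exact ⟨key ⟨k, hk⟩, (congrFun he ⟨k, hk⟩).symm⟩

theorem toRn_orthant (k : Fin n → ℕ) : toRn k ∈ orthant n := fun i => Nat.cast_nonneg _

theorem dot_cast (k : Fin n → ℕ) (ω : Fin n →₀ ℕ) :
    ∑ i, toRn k i * toR ω i = ((∑ i, k i * ω i : ℕ) : ℝ) := by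
  simp [toRn, toR]

theorem exists_H (f : MvPolynomial (Fin n) ℤ_[p]) (hf : f ≠ 0) (k : Fin n → ℕ) :
    ∃ (M : ℕ) (H R : MvPolynomial (Fin n) ℤ_[p]), mP (newtonPoly f) (toRn k) = M ∧
      (∀ x : Fin n → ℤ_[p], eval (fun i => (p : ℤ_[p]) ^ (k i) * x i) f = (p : ℤ_[p]) ^ M * eval x H) ∧
      H = facePoly f (toRn k) + C (p : ℤ_[p]) * R := by
  classical
  obtain ⟨⟨ω0, hω0, h0⟩, hge⟩ := mP_spec f hf (toRn_orthant k)
  rw [dot_cast] at h0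
  set M := ∑ i, k i * ω0 i with hM
  have hle : ∀ ω ∈ f.support, M ≤ ∑ i, k i * ω i := by
    intro ω hω
    have := hge _ (toR_mem f hω)
    rw [dot_cast, h0] at this
    exact_mod_cast this
  have hface : ∀ ω ∈ f.support, (toR ω ∈ faceOf (newtonPoly f) (toRn k) ↔ ∑ i, k i * ω i = M) := by
    intro ω hω
    constructor
    · rintro ⟨_, h⟩
      rw [dot_cast, h0] at h
      exact_mod_cast h
    · intro h
      exact ⟨toR_mem f hω, by rw [dot_cast, h0, h]⟩
  refine ⟨M, ∑ ω ∈ f.support, monomial ω (f.coeff ω * (p : ℤ_[p]) ^ (∑ i, k i * ω i - M)),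
    ∑ ω ∈ f.support with ¬ toR ω ∈ faceOf (newtonPoly f) (toRn k),
      monomial ω (f.coeff ω * (p : ℤ_[p]) ^ (∑ i, k i * ω i - M - 1)), h0, ?_, ?_⟩
  · intro x
    rw [eval_eq', map_sum, Finset.mul_sum]
    apply Finset.sum_congr rfl
    intro ω hω
    rw [eval_monomial, Finsupp.prod_fintype _ _ (by simp)]
    simp only [mul_pow, Finset.prod_mul_distrib, ← pow_mul]
    rw [Finset.prod_pow_eq_pow_sum]
    have : (p : ℤ_[p]) ^ (∑ i, k i * ω i) = (p : ℤ_[p]) ^ M * (p : ℤ_[p]) ^ (∑ i, k i * ω i - M) := by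
      rw [← pow_add, Nat.add_sub_cancel' (hle ω hω)]
    rw [this]; ring
  · rw [facePoly, Finset.mul_sum, ← Finset.sum_filter_add_sum_filter_not f.support
      (fun ω => toR ω ∈ faceOf (newtonPoly f) (toRn k))]
    congr 1
    · convert Finset.sum_congr rfl ?_ using 1
      intro ω hω
      rw [Finset.mem_filter] at hω
      rw [(hface ω hω.1).1 hω.2]; simp
    · apply Finset.sum_congr rfl
      intro ω hω
      rw [Finset.mem_filter] at hω
      have h1 := hle ω hω.1
      have h2 : ∑ i, k i * ω i ≠ M := fun h => hω.2 ((hface ω hω.1).2 h)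
      rw [C_mul_monomial]
      congr 1
      have h3 : ∑ i, k i * ω i - M = (∑ i, k i * ω i - M - 1) + 1 := by omega
      rw [h3, pow_succ, Nat.add_sub_cancel]; ring

theorem conePoly_eq (f g h : MvPolynomial (Fin n) ℤ_[p]) (hh : h = f ∨ h = g) {δ : Set (Fin n → ℝ)} (hδ : δ ∈ Dfg f g)
    {k : Fin n → ℝ} (hk : k ∈ δ) : conePoly h δ = facePoly h k := by
  have hne : δ.Nonempty := ⟨k, hk⟩
  rw [conePoly, dif_pos hne]
  have h1 := hne.some_mem
  generalize hne.some = k1 at *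
  obtain ⟨k0, hk0, rfl⟩ := hδ
  have : faceOf (newtonPoly h) k1 = faceOf (newtonPoly h) k := by
    rcases hh with rfl | rfl
    · exact h1.2.1.trans hk.2.1.symm
    · exact h1.2.2.trans hk.2.2.symm
  unfold facePoly
  rw [this]

end Part4


section Part5
variable {p : ℕ} [Fact p.Prime] {n : ℕ}

/-- lift of residues -/
noncomputable def liftB (b : Fin n → ZMod p) : Fin n → ℤ_[p] := fun i => ((b i).val : ℤ_[p])

theorem toZMod_liftB (b : Fin n → ZMod p) (i : Fin n) : PadicInt.toZMod (liftB b i) = b i := by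
  simp [liftB]

/-- cell -/
noncomputable def cell (q : (Fin n → ℕ) × {b : Fin n → ZMod p // ∀ i, b i ≠ 0}) : Set (Fin n → ℤ_[p]) :=
  Set.range (Taff (fun i => (p : ℤ_[p]) ^ (q.1 i) * liftB q.2.1 i) (fun i => q.1 i + 1))

theorem Taff_cell (k : Fin n → ℕ) (b : Fin n → ZMod p) (x : Fin n → ℤ_[p]) :
    Taff (fun i => (p : ℤ_[p]) ^ (k i) * liftB b i) (fun i => k i + 1) x =
      fun i => (p : ℤ_[p]) ^ (k i) * (liftB b i + p * x i) := by
  ext1 i; simp [Taff, pow_succ]; ring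

theorem not_dvd_lift {b : Fin n → ZMod p} (hb : ∀ i, b i ≠ 0) (x : ℤ_[p]) (i : Fin n) :
    ¬ (p : ℤ_[p]) ∣ liftB b i + p * x := by
  intro h
  have h1 : (p : ℤ_[p]) ∣ liftB b i - 0 := by
    simpa using (dvd_add_left (dvd_mul_right _ _)).1 h
  rw [← toZMod_eq_iff, toZMod_liftB, map_zero] at h1
  exact hb i h1

theorem pow_mul_cancel {a b : ℕ} {u v : ℤ_[p]} (hu : ¬ (p : ℤ_[p]) ∣ u) (hv : ¬ (p : ℤ_[p]) ∣ v)
    (h : (p : ℤ_[p]) ^ a * u = (p : ℤ_[p]) ^ b * v) : a = b ∧ u = v := by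
  have hn := congrArg norm h
  rw [norm_mul, norm_mul, norm_eq_one_of_not_dvd hu, norm_eq_one_of_not_dvd hv, PadicInt.norm_p_pow,
    PadicInt.norm_p_pow, mul_one, mul_one] at hn
  have hp1 : (1 : ℝ) < p := by exact_mod_cast (Fact.out : p.Prime).one_lt
  have := zpow_right_injective₀ (by linarith) hp1.ne' hn
  have hab : a = b := by simpa using this
  subst hab
  exact ⟨rfl, mul_left_cancel₀ (pow_ne_zero _ p_ne) h⟩

theorem cell_disjoint : Pairwise (Function.onFun Disjoint (cell (p := p) (n := n))) := by
  intro q q' hne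
  refine Set.disjoint_left.2 ?_
  rintro y ⟨x, hx⟩ ⟨x', hx'⟩
  apply hne
  rw [← hx', Taff_cell, Taff_cell] at hx
  have key : ∀ i, _ := fun i => pow_mul_cancel (not_dvd_lift q.2.2 (x i) i) (not_dvd_lift q'.2.2 (x' i) i)
    (congrFun hx i)
  refine Prod.ext (funext fun i => (key i).1) (Subtype.ext (funext fun i => ?_))
  have := congrArg PadicInt.toZMod (key i).2
  simpa [toZMod_liftB] using this

theorem cell_cover (y : Fin n → ℤ_[p]) (hy : ∀ i, y i ≠ 0) : ∃ q, y ∈ cell (p := p) q := by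
  let u : Fin n → ℤ_[p] := fun i => (PadicInt.unitCoeff (hy i) : ℤ_[p])
  have hu : ∀ i, y i = u i * (p : ℤ_[p]) ^ (y i).valuation := fun i => PadicInt.unitCoeff_spec (hy i)
  have hb : ∀ i, PadicInt.toZMod (u i) ≠ 0 := fun i =>
    ((PadicInt.unitCoeff (hy i)).isUnit.map (PadicInt.toZMod (p := p))).ne_zero
  have hx : ∀ i, (p : ℤ_[p]) ∣ u i - liftB (fun i => PadicInt.toZMod (u i)) i := by
    intro i
    rw [← toZMod_eq_iff, toZMod_liftB]
  choose x hx using hx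
  refine ⟨(fun i => (y i).valuation, ⟨fun i => PadicInt.toZMod (u i), hb⟩), x, ?_⟩
  rw [Taff_cell]
  ext1 i
  simp only
  rw [← hx, hu i]
  have := hu i
  rw [← this]
  rw [add_sub_cancel, mul_comm]; exact this.symm

theorem coord_null (i : Fin n) : padicHaar p n {x | x i = 0} = 0 := by
  have hp1 : (p : ENNReal)⁻¹ < 1 := by
    rw [ENNReal.inv_lt_one]; exact_mod_cast (Fact.out : p.Prime).one_lt
  have h : ∀ m : ℕ, padicHaar p n {x | x i = 0} ≤ (p : ENNReal)⁻¹ ^ m := by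
    intro m
    calc _ ≤ padicHaar p n (redk (p := p) (Pi.single i m) ⁻¹' {redk _ 0}) := by
            apply measure_mono
            intro x hx
            simp only [Set.mem_preimage, Set.mem_singleton_iff, redk_eq_iff]
            intro j
            by_cases hj : j = i
            · subst hj; rw [show x j = 0 from hx]; simp
            · simp [hj]
      _ = _ := by rw [meas_redk, ENNReal.inv_pow]; simp
  have := ge_of_tendsto' (ENNReal.tendsto_pow_atTop_nhds_zero_of_lt_one hp1) h
  exact le_antisymm this bot_le

theorem hasSum_cells (F : (Fin n → ℤ_[p]) → ℂ) (hF : Continuous F) :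
    HasSum (fun q : (Fin n → ℕ) × {b : Fin n → ZMod p // ∀ i, b i ≠ 0} =>
      ((p : ℂ) ^ (∑ i, (q.1 i + 1)))⁻¹ *
        ∫ x : Fin n → ℤ_[p], F (fun i => (p : ℤ_[p]) ^ (q.1 i) * (liftB q.2.1 i + p * x i)) ∂(padicHaar p n))
      (∫ x, F x ∂(padicHaar p n)) := by
  have h1 := hasSum_integral_iUnion (f := F) (μ := padicHaar p n) (s := cell (p := p) (n := n))
    (fun q => (Taff_emb _ _).measurableSet_range) cell_disjoint (intble hF).integrableOn
  have h2 : (padicHaar p n).restrict (⋃ q, cell (p := p) (n := n) q) = padicHaar p n := by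
    apply Measure.restrict_eq_self_of_ae_mem
    have h3 : ∀ᵐ x ∂(padicHaar p n), ∀ i, x i ≠ 0 := by
      rw [ae_all_iff]
      intro i
      rw [ae_iff]
      simpa using coord_null i
    filter_upwards [h3] with x hx
    exact Set.mem_iUnion.2 (cell_cover x hx)
  rw [h2] at h1
  have e : ∀ q : (Fin n → ℕ) × {b : Fin n → ZMod p // ∀ i, b i ≠ 0},
      ∫ x in cell q, F x ∂(padicHaar p n) = ((p : ℂ) ^ (∑ i, (q.1 i + 1)))⁻¹ *
        ∫ x : Fin n → ℤ_[p], F (fun i => (p : ℤ_[p]) ^ (q.1 i) * (liftB q.2.1 i + p * x i)) ∂(padicHaar p n) := by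
    intro q
    unfold cell
    rw [setIntegral_Taff]
    simp only [Taff_cell]
  simpa only [e] using h1

open Classical in
theorem count_sum (A B : (Fin n → ZMod p) → Prop) (t u : ℂ) :
    ∑ b : {b : Fin n → ZMod p // ∀ i, b i ≠ 0}, (if A b.1 then t else 1) * (if B b.1 then u else 1) =
      ((p : ℂ) - 1) ^ n - (Set.ncard {a : Fin n → ZMod p | (∀ i, a i ≠ 0) ∧ A a ∧ ¬ B a} : ℂ) * (1 - t)
      - (Set.ncard {a : Fin n → ZMod p | (∀ i, a i ≠ 0) ∧ ¬ A a ∧ B a} : ℂ) * (1 - u)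
      - (Set.ncard {a : Fin n → ZMod p | (∀ i, a i ≠ 0) ∧ A a ∧ B a} : ℂ) * (1 - t * u) := by
  have hcard : Fintype.card {b : Fin n → ZMod p // ∀ i, b i ≠ 0} = (p - 1) ^ n := by
    rw [Fintype.card_congr (Equiv.subtypePiEquivPi (p := fun (_ : Fin n) (z : ZMod p) => z ≠ 0)), Fintype.card_pi]
    have : Fintype.card {z : ZMod p // z ≠ 0} = p - 1 := by
      rw [Fintype.card_subtype_compl, ZMod.card]; simp
    simp [this]
  have hn : ∀ Q : (Fin n → ZMod p) → Prop, (Set.ncard {a : Fin n → ZMod p | (∀ i, a i ≠ 0) ∧ Q a} : ℂ) =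
      ∑ b : {b : Fin n → ZMod p // ∀ i, b i ≠ 0}, if Q b.1 then 1 else 0 := by
    intro Q
    have : {a : Fin n → ZMod p | (∀ i, a i ≠ 0) ∧ Q a} =
      ((Finset.univ.filter fun a : Fin n → ZMod p => (∀ i, a i ≠ 0) ∧ Q a : Finset _) : Set _) := by
      ext; simp
    rw [this, Set.ncard_coe_finset, ← Finset.filter_filter, Finset.card_filter]
    push_cast
    exact Finset.sum_subtype _ (by simp) _
  rw [hn, hn, hn]
  have hp1 : ((p : ℂ) - 1) ^ n = ∑ b : {b : Fin n → ZMod p // ∀ i, b i ≠ 0}, (1 : ℂ) := by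
    simp only [Finset.sum_const, Finset.card_univ, hcard, nsmul_eq_mul, mul_one]
    rw [Nat.cast_pow, Nat.cast_sub (Fact.out : p.Prime).one_le]; simp
  rw [hp1, Finset.sum_mul, Finset.sum_mul, Finset.sum_mul, ← Finset.sum_sub_distrib, ← Finset.sum_sub_distrib, ← Finset.sum_sub_distrib]
  apply Finset.sum_congr rfl
  intro b _
  by_cases hA : A b.1 <;> by_cases hB : B b.1 <;> simp [hA, hB]

theorem dvd_iff_redp (h : MvPolynomial (Fin n) ℤ_[p]) (b : Fin n → ZMod p) :
    (p : ℤ_[p]) ∣ eval (liftB b) h ↔ eval b (redp h) = 0 := by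
  have h1 : eval b (redp h) = PadicInt.toZMod (eval (liftB b) h) := by
    rw [redp, eval_map]
    have := eval₂_comp_left (PadicInt.toZMod (p := p)) (RingHom.id _) (liftB b) h
    rw [← eval₂_id, this]
    congr 1
    ext1 i; simp [toZMod_liftB]
  rw [h1, ← map_zero (PadicInt.toZMod (p := p)), toZMod_eq_iff, sub_zero]

theorem summable_sigma : Summable fun k : Fin n → ℕ => ((p : ℝ) ^ (∑ i, k i))⁻¹ := by
  have h := (hasSum_cells (p := p) (n := n) (fun _ => 1) continuous_const).summable
  simp only [integral_const, probReal_univ, one_smul, mul_one] at h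
  have h2 := h.comp_injective (i := fun k : Fin n → ℕ => (k, (⟨fun _ => 1, fun _ => one_ne_zero⟩ :
     {b : Fin n → ZMod p // ∀ i, b i ≠ 0}))) (fun k k' hk => congrArg Prod.fst hk)
  have h3 := (h2.mul_left ((p : ℂ) ^ n)).norm
  refine h3.congr fun k => ?_
  have hp : (p : ℝ) ≠ 0 := by exact_mod_cast (Fact.out : p.Prime).ne_zero
  simp [Finset.sum_add_distrib, pow_add]
  field_simp

end Part5


section Part6
variable {p : ℕ} [Fact p.Prime] {n : ℕ}

theorem norm_pow_mul_cpow (M : ℕ) (z : ℤ_[p]) (s : ℂ) :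
    ((‖(p : ℤ_[p]) ^ M * z‖ : ℝ) : ℂ) ^ s = (((p : ℂ) ^ s) ^ M)⁻¹ * ((‖z‖ : ℝ) : ℂ) ^ s := by
  induction M with
  | zero => simp
  | succ M ih =>
    rw [pow_succ', mul_assoc, norm_p_mul_cpow, ih, pow_succ', mul_inv, mul_assoc]

theorem Sterm_eq (f g : MvPolynomial (Fin n) ℤ_[p]) (s : ℂ) (k : Fin n → ℕ) {M M' : ℕ}
    (hM : mP (newtonPoly f) (toRn k) = M) (hM' : mP (newtonPoly g) (toRn k) = M') :
    Sterm p f g s k = (((p : ℂ) ^ s) ^ M)⁻¹ * ((p : ℂ) ^ M')⁻¹ * ((p : ℂ) ^ (∑ i, k i))⁻¹ := by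
  have h : (sigmaFn k : ℂ) = ((∑ i, k i : ℕ) : ℂ) := by simp [sigmaFn]
  rw [Sterm, hM, hM', h, Complex.cpow_sub _ _ pC_ne, Complex.cpow_sub _ _ pC_ne, Complex.cpow_natCast,
    neg_mul, Complex.cpow_neg, Complex.ofReal_natCast, Complex.ofReal_natCast, Complex.cpow_natCast,
    mul_comm (M : ℂ) s, Complex.cpow_mul_nat]
  rfl

theorem dvd_add_C (F R : MvPolynomial (Fin n) ℤ_[p]) (a : Fin n → ℤ_[p]) :
    (p : ℤ_[p]) ∣ eval a (F + C (p : ℤ_[p]) * R) ↔ (p : ℤ_[p]) ∣ eval a F := by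
  simp only [map_add, map_mul, eval_C]
  exact dvd_add_left (dvd_mul_right _ _)

theorem eval_pderiv_add_C (F R : MvPolynomial (Fin n) ℤ_[p]) (a : Fin n → ℤ_[p]) (i : Fin n) :
    eval a (pderiv i (F + C (p : ℤ_[p]) * R)) = eval a (pderiv i F) + p * eval a (pderiv i R) := by
  simp [pderiv_mul]

theorem isUnit_lift {b : Fin n → ZMod p} (hb : ∀ i, b i ≠ 0) (i : Fin n) : IsUnit (liftB b i) := by
  rw [PadicInt.isUnit_iff]
  have := not_dvd_lift hb 0 i
  rw [mul_zero, add_zero] at this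
  exact norm_eq_one_of_not_dvd this

theorem main_term (f g : MvPolynomial (Fin n) ℤ_[p]) (hf : f ≠ 0) (hg : g ≠ 0)
    (hndf : NonDeg p f) (hndg : NonDeg p g) (hpair : NonDegPair p f g)
    (s : ℂ) (hs : 0 < s.re) (δ : Set (Fin n → ℝ)) (hδ : δ ∈ Dfg f g) (k : Fin n → ℕ) (hk : toRn k ∈ δ) :
    ∑ b : {b : Fin n → ZMod p // ∀ i, b i ≠ 0}, ((p : ℂ) ^ (∑ i, (k i + 1)))⁻¹ *
        ∫ x : Fin n → ℤ_[p],
          (‖eval (fun i => (p : ℤ_[p]) ^ (k i) * (liftB b.1 i + p * x i)) f‖ : ℂ) ^ s *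
          (‖eval (fun i => (p : ℤ_[p]) ^ (k i) * (liftB b.1 i + p * x i)) g‖ : ℂ) ∂(padicHaar p n)
      = Ldelta p f g δ s * Sterm p f g s k := by
  classical
  obtain ⟨M, H, R, hM, hH, hHR⟩ := exists_H f hf k
  obtain ⟨M', H', R', hM', hH', hHR'⟩ := exists_H g hg k
  have hcf := conePoly_eq f g f (Or.inl rfl) hδ hk
  have hcg := conePoly_eq f g g (Or.inr rfl) hδ hk
  have hloc : ∀ b : {b : Fin n → ZMod p // ∀ i, b i ≠ 0}, ∫ x : Fin n → ℤ_[p],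
          (‖eval (fun i => (p : ℤ_[p]) ^ (k i) * (liftB b.1 i + p * x i)) f‖ : ℂ) ^ s *
          (‖eval (fun i => (p : ℤ_[p]) ^ (k i) * (liftB b.1 i + p * x i)) g‖ : ℂ) ∂(padicHaar p n) =
      (((p : ℂ) ^ s) ^ M)⁻¹ * ((p : ℂ) ^ M')⁻¹ *
      ((if eval b.1 (redp (conePoly f δ)) = 0 then ((p : ℂ) - 1) / ((p : ℂ) ^ (s + 1) - 1) else 1) *
      (if eval b.1 (redp (conePoly g δ)) = 0 then ((p : ℂ) - 1) / ((p : ℂ) ^ ((1 : ℂ) + 1) - 1) else 1)) := by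
    intro b
    have hu := isUnit_lift b.2
    have e : ∀ x : Fin n → ℤ_[p],
          (‖eval (fun i => (p : ℤ_[p]) ^ (k i) * (liftB b.1 i + p * x i)) f‖ : ℂ) ^ s *
          (‖eval (fun i => (p : ℤ_[p]) ^ (k i) * (liftB b.1 i + p * x i)) g‖ : ℂ) =
        (((p : ℂ) ^ s) ^ M)⁻¹ * ((p : ℂ) ^ M')⁻¹ *
          ((‖eval (fun i => liftB b.1 i + p * x i) H‖ : ℂ) ^ s *
           (‖eval (fun i => liftB b.1 i + p * x i) H'‖ : ℂ) ^ (1 : ℂ)) := by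
      intro x
      have h1 := norm_pow_mul_cpow M (eval (fun i => liftB b.1 i + p * x i) H) s
      have h2 := norm_pow_mul_cpow M' (eval (fun i => liftB b.1 i + p * x i) H') 1
      rw [← hH] at h1
      rw [← hH', Complex.cpow_one, Complex.cpow_one] at h2
      rw [h1, h2]; ring
    simp only [e]
    rw [integral_const_mul, loc_two hs (by simp)]
    · rw [hHR, hHR', hcf, hcg]
      simp only [dvd_add_C, dvd_iff_redp]
    · rw [hHR, dvd_add_C]
      intro h
      by_contra hcon
      push Not at hcon
      refine hndf _ (toRn_orthant k) ⟨liftB b.1, hu, h, fun i => ?_⟩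
      have := hcon i
      rw [eval_pderiv_add_C] at this
      exact (dvd_add_left (dvd_mul_right _ _)).1 this
    · rw [hHR', dvd_add_C]
      intro h
      by_contra hcon
      push Not at hcon
      refine hndg _ (toRn_orthant k) ⟨liftB b.1, hu, h, fun i => ?_⟩
      have := hcon i
      rw [eval_pderiv_add_C] at this
      exact (dvd_add_left (dvd_mul_right _ _)).1 this
    · rw [hHR, hHR', dvd_add_C, dvd_add_C]
      intro h h'
      by_contra hcon
      push Not at hcon
      refine hpair δ hδ ⟨liftB b.1, hu, hcf ▸ h, hcg ▸ h', fun i j hij => ?_⟩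
      have := hcon i j hij
      simp only [eval_pderiv_add_C] at this
      rw [hcf, hcg]
      simp only [map_sub, map_mul]
      generalize eval (liftB b.1) (pderiv i (facePoly f (toRn k))) = a1 at *
      generalize eval (liftB b.1) (pderiv j (facePoly f (toRn k))) = a2 at *
      generalize eval (liftB b.1) (pderiv i (facePoly g (toRn k))) = a3 at *
      generalize eval (liftB b.1) (pderiv j (facePoly g (toRn k))) = a4 at *
      generalize eval (liftB b.1) (pderiv i R) = r1 at *
      generalize eval (liftB b.1) (pderiv j R) = r2 at *
      generalize eval (liftB b.1) (pderiv i R') = r3 at *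
      generalize eval (liftB b.1) (pderiv j R') = r4 at *
      obtain ⟨c, hc⟩ := this
      exact ⟨c - (a1 * r4 + r1 * a4 + p * r1 * r4 - a2 * r3 - r2 * a3 - p * r2 * r3), by
        linear_combination hc⟩
  simp only [hloc]
  rw [← Finset.mul_sum, ← Finset.mul_sum]
  have hcs := count_sum (p := p) (n := n) (fun b => eval b (redp (conePoly f δ)) = 0)
    (fun b => eval b (redp (conePoly g δ)) = 0) (((p : ℂ) - 1) / ((p : ℂ) ^ (s + 1) - 1))
    (((p : ℂ) - 1) / ((p : ℂ) ^ ((1 : ℂ) + 1) - 1))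
  refine (congrArg (fun z => ((p : ℂ) ^ (∑ i, (k i + 1)))⁻¹ *
    ((((p : ℂ) ^ s) ^ M)⁻¹ * ((p : ℂ) ^ M')⁻¹ * z)) (Eq.trans ?_ hcs)).trans ?_
  · apply Finset.sum_congr
    · congr
    · intro b _
      congr
  rw [Sterm_eq f g s k hM hM']
  have hsum : ∑ i, (k i + 1) = ∑ i, k i + n := by simp [Finset.sum_add_distrib]
  rw [hsum, pow_add, Ldelta, Ndelta, Pdelta, Qdelta]
  have hp := pC_ne (p := p)
  have h1 := ps_ne_one (p := p) hs
  have h2 := ps_ne_one (p := p) (s := 1) (by simp)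
  have h3 : (p : ℂ) ^ ((1 : ℂ) + 1) = (p : ℂ) ^ 2 := by
    rw [← Complex.cpow_natCast]; norm_num
  have h4 : (p : ℂ) + 1 ≠ 0 := by exact_mod_cast Nat.succ_ne_zero p
  have h5 : (p : ℂ) - 1 ≠ 0 := by
    intro h; apply h2; rw [h3]; linear_combination (p + 1 : ℂ) * h
  have e2 : ((p : ℂ) - 1) / ((p : ℂ) ^ ((1 : ℂ) + 1) - 1) = 1 / ((p : ℂ) + 1) := by
    rw [div_eq_div_iff h2 h4, h3]; ring
  have e1 : (1 : ℂ) - ((p : ℂ) - 1) / ((p : ℂ) ^ (s + 1) - 1) = p * ((p : ℂ) ^ s - 1) / ((p : ℂ) ^ (s + 1) - 1) := by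
    rw [eq_div_iff h1, sub_mul, div_mul_cancel₀ _ h1, Complex.cpow_add _ _ hp, Complex.cpow_one]; ring
  have e3 : (1 : ℂ) - 1 / ((p : ℂ) + 1) = p / ((p : ℂ) + 1) := by field_simp; ring
  have e4 : (1 : ℂ) - ((p : ℂ) - 1) / ((p : ℂ) ^ (s + 1) - 1) * (1 / ((p : ℂ) + 1)) =
      p * ((p : ℂ) ^ s * ((p : ℂ) + 1) - 2) / (((p : ℂ) ^ (s + 1) - 1) * ((p : ℂ) + 1)) := by
    rw [div_mul_div_comm, eq_div_iff (mul_ne_zero h1 h4), sub_mul, div_mul_cancel₀ _ (mul_ne_zero h1 h4),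
      Complex.cpow_add _ _ hp, Complex.cpow_one]; ring
  rw [e2, e1, e3, e4, zpow_neg, zpow_natCast, mul_inv]
  simp only [ne_eq]
  ring

theorem Sterm_norm_le (f g : MvPolynomial (Fin n) ℤ_[p]) (hf : f ≠ 0) (hg : g ≠ 0) (s : ℂ) (hs : 0 < s.re)
    (k : Fin n → ℕ) : ‖Sterm p f g s k‖ ≤ ((p : ℝ) ^ (∑ i, k i))⁻¹ := by
  obtain ⟨M, -, -, hM, -, -⟩ := exists_H f hf k
  obtain ⟨M', -, -, hM', -, -⟩ := exists_H g hg k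
  have hp1 : (1 : ℝ) ≤ p := by exact_mod_cast (Fact.out : p.Prime).one_le
  rw [Sterm_eq f g s k hM hM', norm_mul, norm_mul, norm_inv, norm_inv, norm_inv, norm_pow, norm_pow, norm_pow,
    Complex.norm_natCast_cpow_of_pos (Fact.out : p.Prime).pos, Complex.norm_natCast]
  have a1 : (((p : ℝ) ^ s.re) ^ M)⁻¹ ≤ 1 :=
    inv_le_one_of_one_le₀ (one_le_pow₀ (Real.one_le_rpow hp1 hs.le))
  have a2 : ((p : ℝ) ^ M')⁻¹ ≤ 1 := inv_le_one_of_one_le₀ (one_le_pow₀ hp1)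
  refine mul_le_of_le_one_left (by positivity) (mul_le_one₀ a1 (by positivity) a2)

/-- the cone of a point -/
def coneAt (f g : MvPolynomial (Fin n) ℤ_[p]) (k : Fin n → ℕ) : Set (Fin n → ℝ) :=
  {k' ∈ orthant n | faceOf (newtonPoly f) k' = faceOf (newtonPoly f) (toRn k) ∧
    faceOf (newtonPoly g) k' = faceOf (newtonPoly g) (toRn k)}

theorem coneAt_mem (f g : MvPolynomial (Fin n) ℤ_[p]) (k : Fin n → ℕ) : coneAt f g k ∈ Dfg f g :=
  ⟨toRn k, toRn_orthant k, rfl⟩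

theorem mem_coneAt (f g : MvPolynomial (Fin n) ℤ_[p]) (k : Fin n → ℕ) : toRn k ∈ coneAt f g k :=
  ⟨toRn_orthant k, rfl, rfl⟩

theorem coneAt_unique (f g : MvPolynomial (Fin n) ℤ_[p]) (k : Fin n → ℕ) {δ : Set (Fin n → ℝ)} (hδ : δ ∈ Dfg f g)
    (hk : toRn k ∈ δ) : coneAt f g k = δ := by
  obtain ⟨k0, hk0, rfl⟩ := hδ
  obtain ⟨-, h1, h2⟩ := hk
  simp only [coneAt, h1, h2]

/-- decomposition of the lattice points -/
def eqv (f g : MvPolynomial (Fin n) ℤ_[p]) : (Σ δ : Dfg f g, {k : Fin n → ℕ // toRn k ∈ δ.1}) ≃ (Fin n → ℕ) where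
  toFun x := x.2.1
  invFun k := ⟨⟨coneAt f g k, coneAt_mem f g k⟩, ⟨k, mem_coneAt f g k⟩⟩
  left_inv := by
    rintro ⟨⟨δ, hδ⟩, ⟨k, hk⟩⟩
    have := coneAt_unique f g k hδ hk
    subst this
    rfl
  right_inv k := rfl

end Part6
/-- **Theorem (Igusa's zeta function of a polynomial and a polynomial measure).**
If `f, g` are nonzero, vanish at `0`, are non-degenerated over `𝔽_p` w.r.t. their Newton
polyhedra, and the pair `(f,g)` is non-degenerated w.r.t. `D_{f,g}`, then for `Re(s) > 0`
the series `S_δ(s)` converge absolutely and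
`Z_{f,g}(s) = ∫_{ℤ_p^n} |f|^s |g| dμ = Σ_{δ ∈ D_{f,g}} L_δ(s) S_δ(s)`
(the partition `D_{f,g}` being finite). -/
theorem igusa_zeta_poly_measure (p : ℕ) [Fact p.Prime] (n : ℕ) (hn : 2 ≤ n)
    (f g : MvPolynomial (Fin n) ℤ_[p]) (hf : f ≠ 0) (hg : g ≠ 0)
    (hf0 : f.coeff 0 = 0) (hg0 : g.coeff 0 = 0)
    (hndf : NonDeg p f) (hndg : NonDeg p g) (hpair : NonDegPair p f g)
    (s : ℂ) (hs : 0 < s.re) :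
    (Dfg f g).Finite ∧
    (∀ δ ∈ Dfg f g,
      Summable (fun k : {k : Fin n → ℕ // toRn k ∈ δ} => ‖Sterm p f g s k‖)) ∧
    ∫ x, (‖eval x f‖ : ℂ) ^ s * (‖eval x g‖ : ℂ) ∂(padicHaar p n)
      = ∑' δ : Dfg f g, Ldelta p f g δ s * Sdelta p f g δ s := by

  have hsm : ∀ δ ∈ Dfg f g,
      Summable (fun k : {k : Fin n → ℕ // toRn k ∈ δ} => ‖Sterm p f g s k‖) := by
    intro δ hδ
    exact Summable.of_nonneg_of_le (fun _ => norm_nonneg _) (fun k => Sterm_norm_le f g hf hg s hs k)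
      ((summable_sigma (p := p) (n := n)).comp_injective Subtype.val_injective)
  refine ⟨Dfg_finite f g hf hg, hsm, ?_⟩
  have hF : Continuous fun x : Fin n → ℤ_[p] => (‖eval x f‖ : ℂ) ^ s * (‖eval x g‖ : ℂ) :=
    (cont_cpow hs (continuous_eval' f)).mul (Complex.continuous_ofReal.comp (continuous_eval' g).norm)
  have h1 := (hasSum_cells _ hF).prod_fiberwise (fun k => hasSum_fintype _)
  have h2 := (eqv f g).hasSum_iff.2 h1
  have h3 := h2.sigma (g := fun δ : Dfg f g => Ldelta p f g δ s * Sdelta p f g δ s) (by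
    intro δ
    have e : ∀ k : {k : Fin n → ℕ // toRn k ∈ δ.1}, _ := fun k =>
      main_term f g hf hg hndf hndg hpair s hs δ.1 δ.2 k.1 k.2
    have h4 := ((hsm δ.1 δ.2).of_norm.hasSum).mul_left (Ldelta p f g δ s)
    exact h4.congr_fun (fun k => e k))
  exact h3.tsum_eq.symm
end

section
/- Let p be a prime, n ≥ 2, and f, g ∈ ℤ_p[x_1,…,x_n]. Let N = #{a ∈ (F_p^×)^n : f̄(a) = 0 and ḡ(a) ≠ 0}, P = #{a ∈ (F_p^×)^n : f̄(a) ≠ 0 and ḡ(a) = 0}, Q = #{a ∈ (F_p^×)^n : f̄(a) = ḡ(a) = 0}. Suppose that none of the following three systems of congruences has a solution in (ℤ_p^×)^n: (1) f(x) ≡ 0 and ∂f/∂x_i(x) ≡ 0 mod p for i = 1,…,n; (2) g(x) ≡ 0 and ∂g/∂x_i(x) ≡ 0 mod p for i = 1,…,n; (3) f(x) ≡ 0, g(x) ≡ 0, and (∂f/∂x_i · ∂g/∂x_j − ∂f/∂x_j · ∂g/∂x_i)(x) ≡ 0 mod p for all 1 ≤ i < j ≤ n. Then for every complex s with Re(s)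 > 0: ∫_{(ℤ_p^×)^n} |f(x)|^s |g(x)| dμ = p^{-n}((p−1)^n − pN(p^s−1)/(p^{s+1}−1) − P·p/(p+1) − pQ(p^s(p+1)−2)/((p^{s+1}−1)(p+1))). -/
open MeasureTheory MvPolynomial

/-- `(ℤ_p^×)^n`, as a subset of `ℤ_p^n`. -/
def unitsSet (p : ℕ) [Fact p.Prime] (n : ℕ) : Set (Fin n → ℤ_[p]) :=
  {x | ∀ i, IsUnit (x i)}

lemma aux_isometry_surj {X : Type*} [MetricSpace X] [CompactSpace X] (T : X → X)
    (hT : Isometry T) : Function.Surjective T := by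
  intro x
  by_contra hx
  have hcl : IsClosed (Set.range T) := (isCompact_range hT.continuous).isClosed
  have hx' : x ∈ (Set.range T)ᶜ := hx
  obtain ⟨d, hd, hball⟩ := Metric.isOpen_iff.1 hcl.isOpen_compl x hx'
  have key : ∀ y, d ≤ dist x (T y) := by
    intro y
    by_contra h
    push Not at h
    have : T y ∈ Metric.ball x d := by rwa [Metric.mem_ball, dist_comm]
    exact hball this ⟨y, rfl⟩
  have hit : ∀ m : ℕ, Isometry (T^[m]) := by
    intro m
    induction m with
    | zero => exact isometry_id
    | succ k ih => rw [Function.iterate_succ]; exact ih.comp hT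
  have sep : ∀ m k : ℕ, d ≤ dist (T^[m] x) (T^[m + k + 1] x) := by
    intro m k
    rw [add_assoc, Function.iterate_add_apply, (hit m).dist_eq, Function.iterate_succ_apply']
    exact key _
  obtain ⟨a, -, φ, hφ, hlim⟩ := isCompact_univ.tendsto_subseq (x := fun m => T^[m] x) (fun _ => Set.mem_univ _)
  have hc := hlim.cauchySeq
  obtain ⟨M, hM⟩ := Metric.cauchySeq_iff.1 hc d hd
  have h1 := hM M le_rfl (M+1) (Nat.le_succ M)
  obtain ⟨k, hk⟩ := Nat.exists_eq_add_of_lt (hφ (Nat.lt_succ_self M))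
  have h2 := sep (φ M) k
  simp only [Function.comp] at h1
  rw [Nat.succ_eq_add_one] at hk
  rw [hk] at h1
  linarith

lemma aux_isometry_mp {G : Type*} [NormedAddCommGroup G] [CompactSpace G] [IsUltrametricDist G]
    [MeasurableSpace G] [BorelSpace G] (μ : Measure G) [μ.IsAddHaarMeasure]
    (T : G → G) (hT : Isometry T) : μ.map T = μ := by
  have hs := aux_isometry_surj T hT
  have hm : Measurable T := hT.continuous.measurable
  set C : Set (Set G) := {S | ∃ x r, 0 < r ∧ S = Metric.ball x r} with hC
  have hbasis : TopologicalSpace.IsTopologicalBasis C := by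
    apply TopologicalSpace.isTopologicalBasis_of_isOpen_of_nhds
    · rintro u ⟨x, r, -, rfl⟩; exact Metric.isOpen_ball
    · intro a u ha hu
      obtain ⟨r, hr, h⟩ := Metric.isOpen_iff.1 hu a ha
      exact ⟨_, ⟨a, r, hr, rfl⟩, Metric.mem_ball_self hr, h⟩
  apply ext_of_generate_finite C
  · rw [← hbasis.borel_eq_generateFrom]; exact BorelSpace.measurable_eq
  · rintro _ ⟨x, r, hr, rfl⟩ _ ⟨y, r', hr', rfl⟩ ⟨z, hz1, hz2⟩
    rcases IsUltrametricDist.ball_subset_trichotomy x y r r' with h | h | h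
    · rw [Set.inter_eq_left.2 h]; exact ⟨x, r, hr, rfl⟩
    · rw [Set.inter_eq_right.2 h]; exact ⟨y, r', hr', rfl⟩
    · exact (Set.disjoint_left.1 h hz1 hz2).elim
  · rintro _ ⟨x, r, hr, rfl⟩
    obtain ⟨y, rfl⟩ := hs x
    rw [Measure.map_apply hm Metric.isOpen_ball.measurableSet, hT.preimage_ball]
    have : Metric.ball y r = (fun z => (T y - y) + z) ⁻¹' Metric.ball (T y) r := by
      ext z
      simp only [Metric.mem_ball, Set.mem_preimage, dist_eq_norm]
      congr! 2
      abel
    rw [this, measure_preimage_add]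
  · rw [Measure.map_apply hm MeasurableSet.univ, Set.preimage_univ]

lemma aux_class {G : Type*} [AddCommGroup G] [TopologicalSpace G] [IsTopologicalAddGroup G]
    [CompactSpace G] [T2Space G] [SecondCountableTopology G] [MeasurableSpace G] [BorelSpace G]
    (μ : Measure G) [μ.IsAddHaarMeasure] [IsProbabilityMeasure μ]
    {H : Type*} [AddCommGroup H] [Fintype H] (r : G →+ H) (hr : Function.Surjective r)
    (φ : G →+ G) (hφ : Continuous φ) (hinj : Function.Injective φ)
    (hk : ∀ x, r x = 0 ↔ ∃ t, φ t = x) :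
    (∀ h, MeasurableSet (r ⁻¹' {h})) ∧ ∀ (c : G) (F : G → ℂ),
      ∫ x in r ⁻¹' {r c}, F x ∂μ = (Fintype.card H : ℂ)⁻¹ * ∫ t, F (c + φ t) ∂μ := by
  have hrange : ∀ c, r ⁻¹' {r c} = Set.range (fun t => c + φ t) := by
    intro c
    ext x
    have := hk (x - c)
    simp only [map_sub, sub_eq_zero] at this
    simp only [Set.mem_preimage, Set.mem_singleton_iff, this, Set.mem_range, eq_sub_iff_add_eq']
  have hemb : ∀ c, MeasurableEmbedding (fun t => c + φ t) := fun c =>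
    (Continuous.isClosedEmbedding (by fun_prop)
      (fun a b hab => hinj (add_left_cancel hab))).measurableEmbedding
  have hmeas : ∀ h, MeasurableSet (r ⁻¹' {h}) := by
    intro h
    obtain ⟨c, rfl⟩ := hr h
    rw [hrange]
    exact (hemb c).measurableSet_range
  refine ⟨hmeas, fun c F => ?_⟩
  have heq : ∀ h, μ (r ⁻¹' {h}) = μ (r ⁻¹' {r c}) := by
    intro h
    obtain ⟨c', rfl⟩ := hr h
    rw [← measure_preimage_add μ (c' - c) (r ⁻¹' {r c'})]
    congr 1
    ext x
    simp [sub_add_eq_add_sub, sub_eq_iff_eq_add]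
  have hcard : (Fintype.card H : ENNReal) * μ (r ⁻¹' {r c}) = 1 := by
    have : μ Set.univ = ∑ h : H, μ (r ⁻¹' {h}) := by
      rw [← tsum_fintype (L := .unconditional _), ← measure_iUnion _ hmeas]
      · congr 1; ext x; simp
      · intro a b hab
        exact Set.disjoint_left.2 fun x hx hx' => hab (by
          simp only [Set.mem_preimage, Set.mem_singleton_iff] at hx hx'; rw [← hx, ← hx'])
    rw [measure_univ] at this
    rw [this, Finset.sum_congr rfl (fun h _ => heq h)]
    simp
  have hreal : μ.real (r ⁻¹' {r c}) = (Fintype.card H : ℝ)⁻¹ := by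
    have := congrArg ENNReal.toReal hcard
    simp only [ENNReal.toReal_mul, ENNReal.toReal_natCast, ENNReal.toReal_one] at this
    exact eq_inv_of_mul_eq_one_right this
  set ψ : G → G := fun t => c + φ t with hψ
  set l := μ.comap ψ with hl
  have hlA : ∀ A, l A = μ (ψ '' A) := fun A => (hemb c).comap_apply μ A
  have : IsFiniteMeasure l := ⟨by rw [hlA]; exact measure_lt_top _ _⟩
  have : l.IsAddLeftInvariant := by
    refine ⟨fun d => ?_⟩
    ext A hA
    rw [Measure.map_apply (by fun_prop) hA, hlA, hlA, ← measure_preimage_add μ (φ d) (ψ '' A)]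
    congr 1
    ext x
    simp only [Set.mem_image, Set.mem_preimage, hψ]
    constructor
    · rintro ⟨t, ht, rfl⟩
      exact ⟨d + t, ht, by simp; abel⟩
    · rintro ⟨t, ht, h⟩
      refine ⟨t - d, by simpa using ht, ?_⟩
      rw [map_sub, ← add_sub_assoc, h]; abel
  have hls := Measure.isAddLeftInvariant_eq_smul l μ
  set k := Measure.addHaarScalarFactor l μ
  have hkk : (k : ℝ) = (Fintype.card H : ℝ)⁻¹ := by
    rw [← hreal, hrange, measureReal_def, ← Set.image_univ, ← hlA, hls]
    simp
  have h1 : μ.restrict (r ⁻¹' {r c}) = l.map ψ := by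
    rw [hrange, (hemb c).map_comap]
  rw [h1, (hemb c).integral_map, hls, integral_smul_nnreal_measure, NNReal.smul_def, hkk]
  simp

lemma aux_dvd_of_norm_le {p : ℕ} [Fact p.Prime] (a b : ℤ_[p]) (h : ‖b‖ ≤ ‖a‖) : ∃ w, b = a * w := by
  by_cases ha : a = 0
  · subst ha
    exact ⟨0, by simpa using h⟩
  have ha' : (a : ℚ_[p]) ≠ 0 := by simpa using ha
  refine ⟨⟨(b : ℚ_[p]) / a, ?_⟩, ?_⟩
  · rw [norm_div]
    exact div_le_one_of_le₀ (by simpa using h) (norm_nonneg _)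
  · apply Subtype.ext
    change (b : ℚ_[p]) = a * (b / a)
    field_simp

lemma aux_taylor {R : Type*} [CommRing R] {n : ℕ} (F : MvPolynomial (Fin n) R)
    (y w : Fin n → R) (z : R) :
    ∃ q, eval (y + z • w) F = eval y F + z * (∑ l, eval y (pderiv l F) * w l) + z ^ 2 * q := by
  induction F using MvPolynomial.induction_on with
  | C a => exact ⟨0, by simp⟩
  | add P Q hP hQ =>
    obtain ⟨a, ha⟩ := hP
    obtain ⟨b, hb⟩ := hQ
    refine ⟨a + b, ?_⟩
    simp only [map_add, ha, hb, add_mul, Finset.sum_add_distrib]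
    ring
  | mul_X P i hP =>
    obtain ⟨a, ha⟩ := hP
    have : ∑ l, eval y (pderiv l (P * X i)) * w l
        = (∑ l, eval y (pderiv l P) * w l) * y i + eval y P * w i := by
      have : ∀ l, eval y (pderiv l (P * X i)) * w l
        = eval y (pderiv l P) * w l * y i + (if l = i then eval y P * w l else 0) := by
        intro l
        rw [pderiv_mul, pderiv_X]
        by_cases h : l = i
        · subst h; simp; ring
        · simp [h]; ring
      simp only [this, Finset.sum_add_distrib, Finset.sum_mul]
      simp
    refine ⟨a * (y i + z * w i) + (∑ l, eval y (pderiv l P) * w l) * w i, ?_⟩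
    rw [this]
    simp only [map_mul, ha, eval_X, Pi.add_apply, Pi.smul_apply, smul_eq_mul]
    ring

lemma aux_eval_congr {R : Type*} [CommRing R] {n : ℕ} (F : MvPolynomial (Fin n) R)
    (y w : Fin n → R) (z : R) : z ∣ eval (y + z • w) F - eval y F := by
  obtain ⟨q, hq⟩ := aux_taylor F y w z
  rw [hq]
  exact ⟨(∑ l, eval y (pderiv l F) * w l) + z * q, by ring⟩

lemma aux_T {p : ℕ} [Fact p.Prime] {n : ℕ} (F : Fin n → MvPolynomial (Fin n) ℤ_[p])
    (c : Fin n → ℤ_[p]) (h0 : ∀ k, (p : ℤ_[p]) ∣ eval c (F k))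
    (hJ : ∀ w : Fin n → ℤ_[p], (∀ k, (p : ℤ_[p]) ∣ ∑ l, eval c (pderiv l (F k)) * w l) →
      ∀ l, (p : ℤ_[p]) ∣ w l) :
    ∃ T : (Fin n → ℤ_[p]) → (Fin n → ℤ_[p]), Isometry T ∧
      ∀ t k, eval (c + (p : ℤ_[p]) • t) (F k) = p * T t k := by
  have hp0 : (p : ℤ_[p]) ≠ 0 := PadicInt.prime_p.ne_zero
  have hd : ∀ t k, (p : ℤ_[p]) ∣ eval (c + (p : ℤ_[p]) • t) (F k) := fun t k => by
    have := dvd_add (aux_eval_congr (F k) c t p) (h0 k)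
    simpa using this
  choose T hT using hd
  refine ⟨T, Isometry.of_dist_eq fun t u => ?_, hT⟩
  by_cases htu : t = u
  · simp [htu]
  have : Nonempty (Fin n) := by
    by_contra h
    rw [not_nonempty_iff] at h
    exact htu (Subsingleton.elim _ _)
  obtain ⟨m, hm⟩ := Finite.exists_max (fun l => ‖(t - u) l‖)
  have hnorm : ‖t - u‖ = ‖(t - u) m‖ :=
    le_antisymm ((pi_norm_le_iff_of_nonneg (norm_nonneg _)).2 hm) (norm_le_pi_norm _ m)
  set d := (t - u) m with hdd
  have hd0 : d ≠ 0 := by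
    rw [← norm_ne_zero_iff, ← hnorm, norm_ne_zero_iff]
    exact sub_ne_zero.2 htu
  choose w hw using fun l => aux_dvd_of_norm_le d ((t - u) l) (hm l)
  have hwm : w m = 1 := by
    have := hw m
    rw [← hdd] at this
    exact mul_left_cancel₀ hd0 (by rw [← this, mul_one])
  set y := c + (p : ℤ_[p]) • u with hy
  have hty : c + (p : ℤ_[p]) • t = y + ((p : ℤ_[p]) * d) • w := by
    ext l
    have := hw l
    simp only [hy, Pi.add_apply, Pi.smul_apply, smul_eq_mul, Pi.sub_apply] at this ⊢
    rw [mul_assoc, ← this]; ring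
  choose q hq using fun k => aux_taylor (F k) y w ((p : ℤ_[p]) * d)
  set e : Fin n → ℤ_[p] := fun k => (∑ l, eval y (pderiv l (F k)) * w l) + p * (d * q k) with he
  have hTe : ∀ k, (T t - T u) k = d * e k := by
    intro k
    apply mul_left_cancel₀ hp0
    have h1 := hT t k
    have h2 := hT u k
    rw [hty, hq k, h2] at h1
    simp only [Pi.sub_apply, he]
    linear_combination -h1
  have hex : ∃ k, ¬ (p : ℤ_[p]) ∣ e k := by
    by_contra hcon
    push Not at hcon
    have : (p : ℤ_[p]) ∣ w m := by
      apply hJ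
      intro k
      have h1 : (p : ℤ_[p]) ∣ ∑ l, eval y (pderiv l (F k)) * w l :=
        (dvd_add_left (dvd_mul_right _ _)).1 (hcon k)
      have h2 : (p : ℤ_[p]) ∣ ∑ l, (eval y (pderiv l (F k)) - eval c (pderiv l (F k))) * w l :=
        Finset.dvd_sum fun l _ => Dvd.dvd.mul_right (aux_eval_congr _ c u p) _
      have h3 := dvd_sub h1 h2
      rw [← Finset.sum_sub_distrib] at h3
      convert h3 using 2
      ring
    rw [hwm] at this
    exact PadicInt.prime_p.not_dvd_one this
  obtain ⟨k, hk⟩ := hex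
  have hek : ‖e k‖ = 1 := by
    refine le_antisymm (PadicInt.norm_le_one _) (not_lt.1 fun h => hk ?_)
    exact (PadicInt.norm_lt_one_iff_dvd _).1 h
  rw [dist_eq_norm, dist_eq_norm, hnorm]
  apply le_antisymm
  · refine (pi_norm_le_iff_of_nonneg (norm_nonneg _)).2 fun k => ?_
    rw [hTe, norm_mul]
    exact mul_le_of_le_one_right (norm_nonneg _) (PadicInt.norm_le_one _)
  · have := norm_le_pi_norm (T t - T u) k
    rwa [hTe, norm_mul, hek, mul_one] at this

lemma aux_one {p : ℕ} [Fact p.Prime] {n : ℕ} (f : MvPolynomial (Fin n) ℤ_[p])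
    (c : Fin n → ℤ_[p]) (h0 : (p : ℤ_[p]) ∣ eval c f) (i : Fin n)
    (hi : ¬ (p : ℤ_[p]) ∣ eval c (pderiv i f)) :
    ∃ T : (Fin n → ℤ_[p]) → (Fin n → ℤ_[p]), Isometry T ∧
      ∀ t, eval (c + (p : ℤ_[p]) • t) f = p * T t i := by
  refine Exists.elim (aux_T (fun k => if k = i then f else X k - C (c k)) c ?_ ?_) ?_
  rotate_left 2
  · rintro T ⟨hT, h⟩
    exact ⟨T, hT, fun t => by simpa using h t i⟩
  · intro k
    by_cases hk : k = i
    · simpa [hk] using h0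
    · simp [hk]
  · intro w hw
    have h1 : ∀ k, k ≠ i → (p : ℤ_[p]) ∣ w k := by
      intro k hk
      have := hw k
      simpa [hk, pderiv_X, Pi.single_apply, apply_ite] using this
    have h2 : (p : ℤ_[p]) ∣ w i := by
      have := hw i
      simp only [if_true] at this
      rw [← Finset.add_sum_erase _ _ (Finset.mem_univ i)] at this
      rw [dvd_add_left (Finset.dvd_sum fun k hk =>
        Dvd.dvd.mul_left (h1 k (Finset.ne_of_mem_erase hk)) _)] at this
      exact (PadicInt.prime_p.dvd_or_dvd this).resolve_left hi
    intro l
    by_cases hl : l = i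
    · rw [hl]; exact h2
    · exact h1 l hl

lemma aux_two {p : ℕ} [Fact p.Prime] {n : ℕ} (f g : MvPolynomial (Fin n) ℤ_[p])
    (c : Fin n → ℤ_[p]) (h0 : (p : ℤ_[p]) ∣ eval c f) (h0' : (p : ℤ_[p]) ∣ eval c g)
    (i j : Fin n) (hij : i ≠ j)
    (hi : ¬ (p : ℤ_[p]) ∣ eval c (pderiv i f * pderiv j g - pderiv j f * pderiv i g)) :
    ∃ T : (Fin n → ℤ_[p]) → (Fin n → ℤ_[p]), Isometry T ∧
      (∀ t, eval (c + (p : ℤ_[p]) • t) f = p * T t i) ∧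
      (∀ t, eval (c + (p : ℤ_[p]) • t) g = p * T t j) := by
  refine Exists.elim (aux_T
    (fun k => if k = i then f else if k = j then g else X k - C (c k)) c ?_ ?_) ?_
  rotate_left 2
  · rintro T ⟨hT, h⟩
    exact ⟨T, hT, fun t => by simpa using h t i, fun t => by simpa [hij.symm] using h t j⟩
  · intro k
    by_cases hk : k = i
    · simpa [hk] using h0
    · by_cases hk' : k = j
      · simpa [hk', hij.symm] using h0'
      · simp [hk, hk']
  · intro w hw
    have h1 : ∀ k, k ≠ i → k ≠ j → (p : ℤ_[p]) ∣ w k := by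
      intro k hk hk'
      have := hw k
      simpa [hk, hk', pderiv_X, Pi.single_apply, apply_ite] using this
    have key : ∀ e : MvPolynomial (Fin n) ℤ_[p],
        (p : ℤ_[p]) ∣ ∑ l, eval c (pderiv l e) * w l →
        (p : ℤ_[p]) ∣ eval c (pderiv i e) * w i + eval c (pderiv j e) * w j := by
      intro e this
      rw [← Finset.add_sum_erase _ _ (Finset.mem_univ i),
        ← Finset.add_sum_erase (Finset.univ.erase i) _ (Finset.mem_erase.2 ⟨hij.symm, Finset.mem_univ j⟩),
        ← add_assoc] at this
      rwa [dvd_add_left (Finset.dvd_sum fun k hk =>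
        Dvd.dvd.mul_left (h1 k (Finset.ne_of_mem_erase (Finset.mem_of_mem_erase hk))
          (Finset.ne_of_mem_erase hk)) _)] at this
    have hf := key f (by simpa using hw i)
    have hg := key g (by simpa [hij.symm] using hw j)
    simp only [map_sub, map_mul] at hi
    have h2 : (p : ℤ_[p]) ∣ w i := by
      have := dvd_sub (hf.mul_left (eval c (pderiv j g))) (hg.mul_left (eval c (pderiv j f)))
      refine (PadicInt.prime_p.dvd_or_dvd (b := w i) (a := _) ?_).resolve_left hi
      convert this using 1
      ring
    have h3 : (p : ℤ_[p]) ∣ w j := by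
      have := dvd_sub (hg.mul_left (eval c (pderiv i f))) (hf.mul_left (eval c (pderiv i g)))
      refine (PadicInt.prime_p.dvd_or_dvd (b := w j) (a := _) ?_).resolve_left hi
      convert this using 1
      ring
    intro l
    by_cases hl : l = i
    · rw [hl]; exact h2
    · by_cases hl' : l = j
      · rw [hl']; exact h3
      · exact h1 l hl hl'

lemma aux_toZMod_zero {p : ℕ} [Fact p.Prime] (x : ℤ_[p]) :
    PadicInt.toZMod x = 0 ↔ (p : ℤ_[p]) ∣ x := by
  rw [← RingHom.mem_ker, PadicInt.ker_toZMod, PadicInt.maximalIdeal_eq_span_p,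
    Ideal.mem_span_singleton]

lemma aux_norm_one {p : ℕ} [Fact p.Prime] (x : ℤ_[p]) (h : ¬ (p : ℤ_[p]) ∣ x) : ‖x‖ = 1 := by
  refine le_antisymm (PadicInt.norm_le_one _) (not_lt.1 fun h' => h ?_)
  exact (PadicInt.norm_lt_one_iff_dvd _).1 h'

lemma aux_norm_cpow_le {p : ℕ} [Fact p.Prime] (x : ℤ_[p]) (s : ℂ) (hs : 0 < s.re) :
    ‖(‖x‖ : ℂ) ^ s‖ ≤ 1 := by
  rcases eq_or_ne x 0 with rfl | hx
  · have : s ≠ 0 := by rintro rfl; simp at hs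
    simp [Complex.zero_cpow this]
  · rw [Complex.norm_cpow_eq_rpow_re_of_pos (norm_pos_iff.2 hx)]
    exact Real.rpow_le_one (norm_nonneg _) (PadicInt.norm_le_one _) hs.le

/-- normalized Haar measure on `ℤ_p` -/
noncomputable def padicHaarOne (p : ℕ) [Fact p.Prime] : Measure ℤ_[p] :=
  Measure.addHaarMeasure ⟨⟨Set.univ, isCompact_univ⟩, by simp⟩

instance aux_inst1 (p : ℕ) [Fact p.Prime] : (padicHaarOne p).IsAddHaarMeasure := by
  unfold padicHaarOne; infer_instance

instance aux_inst2 (p : ℕ) [Fact p.Prime] : IsProbabilityMeasure (padicHaarOne p) :=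
  ⟨Measure.addHaarMeasure_self⟩

instance aux_inst3 (p : ℕ) [Fact p.Prime] (n : ℕ) : (padicHaar p n).IsAddHaarMeasure := by
  unfold padicHaar; infer_instance

instance aux_inst4 (p : ℕ) [Fact p.Prime] (n : ℕ) : IsProbabilityMeasure (padicHaar p n) :=
  ⟨Measure.addHaarMeasure_self⟩

lemma aux_haar_pi (p : ℕ) [Fact p.Prime] (n : ℕ) :
    padicHaar p n = Measure.pi (fun _ => padicHaarOne p) :=
  Measure.isAddHaarMeasure_eq_of_isProbabilityMeasure _ _

lemma aux_p_cpow_ne {p : ℕ} (hp : p.Prime) (s : ℂ) (hs : 0 < s.re) :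
    (p : ℂ) ^ s * p - 1 ≠ 0 := by
  intro h
  have h1 : (p : ℂ) ^ s * p = 1 := by linear_combination h
  have h2 := congrArg norm h1
  have hp1 : (1 : ℝ) < p := by exact_mod_cast hp.one_lt
  rw [norm_mul, Complex.norm_natCast_cpow_of_pos hp.pos, Complex.norm_natCast, norm_one] at h2
  have h3 : (1 : ℝ) < (p : ℝ) ^ s.re := Real.one_lt_rpow hp1 hs
  nlinarith

lemma aux_meas_cpow {p : ℕ} [Fact p.Prime] (s : ℂ) :
    Measurable (fun t : ℤ_[p] => (‖t‖ : ℂ) ^ s) := by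
  have : Measurable (fun t : ℤ_[p] => ‖t‖) := continuous_norm.measurable
  fun_prop

lemma aux_J (p : ℕ) [hp : Fact p.Prime] (s : ℂ) (hs : 0 < s.re) :
    ∫ t, (‖(p : ℤ_[p]) * t‖ : ℂ) ^ s ∂(padicHaarOne p) = ((p : ℂ) - 1) / ((p : ℂ) ^ s * p - 1) := by
  have hp0 : (p : ℂ) ≠ 0 := by exact_mod_cast hp.1.ne_zero
  obtain ⟨hmeas, hint⟩ := aux_class (padicHaarOne p) (PadicInt.toZMod (p := p)).toAddMonoidHom
    (ZMod.ringHom_surjective PadicInt.toZMod) (AddMonoidHom.mulLeft (p : ℤ_[p]))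
    (by simpa using continuous_const_mul (p : ℤ_[p]))
    (fun a b h => mul_left_cancel₀ PadicInt.prime_p.ne_zero h)
    (fun x => by
      change PadicInt.toZMod x = 0 ↔ _
      rw [aux_toZMod_zero]
      exact ⟨fun ⟨t, h⟩ => ⟨t, h.symm⟩, fun ⟨t, h⟩ => ⟨t, h.symm⟩⟩)
  set r := (PadicInt.toZMod (p := p)).toAddMonoidHom with hr
  set F : ℤ_[p] → ℂ := fun t => (‖t‖ : ℂ) ^ s with hF
  have hFi : Integrable F (padicHaarOne p) :=
    Integrable.of_bound (aux_meas_cpow s).aestronglyMeasurable 1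
      (Filter.Eventually.of_forall fun t => aux_norm_cpow_le t s hs)
  have hsum : ∫ t, F t ∂(padicHaarOne p) = ∑ a : ZMod p, ∫ t in r ⁻¹' {a}, F t ∂(padicHaarOne p) := by
    rw [← integral_iUnion_fintype hmeas _ (fun _ => hFi.integrableOn)]
    · rw [← setIntegral_univ]
      congr 2
      ext x; simp
    · intro a b hab
      exact Set.disjoint_left.2 fun x hx hx' => hab (by
          simp only [Set.mem_preimage, Set.mem_singleton_iff] at hx hx'; rw [← hx, ← hx'])
  set J := ∫ t, (‖(p : ℤ_[p]) * t‖ : ℂ) ^ s ∂(padicHaarOne p) with hJ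
  have hval : ∀ a : ZMod p, ∫ t in r ⁻¹' {a}, F t ∂(padicHaarOne p)
      = if a = 0 then (p : ℂ)⁻¹ * J else (p : ℂ)⁻¹ := by
    intro a
    obtain ⟨c, rfl⟩ := ZMod.ringHom_surjective (PadicInt.toZMod (p := p)) a
    split_ifs with h
    · have := hint 0 F
      rw [map_zero] at this
      rw [h, this]
      simp [hF, hJ]
    · refine (hint c F).trans ?_
      rw [aux_toZMod_zero] at h
      have : ∀ t, F (c + AddMonoidHom.mulLeft (p : ℤ_[p]) t) = 1 := by
        intro t
        have : ‖c + (p : ℤ_[p]) * t‖ = 1 := aux_norm_one _ fun h' =>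
          h ((dvd_add_left (dvd_mul_right _ _)).1 h')
        simp [hF, this]
      simp only [this]
      simp
  have hJI : (p : ℂ) ^ s * J = ∫ t, F t ∂(padicHaarOne p) := by
    rw [hJ, ← integral_const_mul]
    congr 1
    ext t
    rw [norm_mul, PadicInt.norm_p, Complex.ofReal_mul, Complex.mul_cpow_ofReal_nonneg (by positivity) (norm_nonneg _)]
    rw [← mul_assoc, hF]
    have : (p : ℂ) ^ s * (((p : ℝ)⁻¹ : ℝ) : ℂ) ^ s = 1 := by
      rw [← Complex.ofReal_natCast, ← Complex.mul_cpow_ofReal_nonneg (by positivity) (by positivity),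
        ← Complex.ofReal_mul, mul_inv_cancel₀ (by exact_mod_cast hp.1.ne_zero)]
      simp
    rw [this, one_mul]
  rw [← hJI, Finset.sum_congr rfl (fun a _ => hval a), Finset.sum_ite] at hsum
  have hc : (Finset.univ.filter (fun a : ZMod p => ¬ a = 0)).card = p - 1 := by
    rw [Finset.filter_not, Finset.filter_eq']
    simp [Finset.card_sdiff, ZMod.card]
  rw [Finset.filter_eq'] at hsum
  simp only [Finset.mem_univ, if_true, Finset.sum_const, hc, Finset.card_singleton, one_smul,
    nsmul_eq_mul, Nat.cast_sub hp.1.one_le, Nat.cast_one] at hsum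
  rw [eq_div_iff (aux_p_cpow_ne hp.1 s hs)]
  field_simp at hsum
  linear_combination hsum

lemma aux_int_one (p : ℕ) [hp : Fact p.Prime] {n : ℕ} (i : Fin n) (s : ℂ) (hs : 0 < s.re) :
    ∫ x, (‖(p : ℤ_[p]) * x i‖ : ℂ) ^ s ∂(padicHaar p n)
      = ((p : ℂ) - 1) / ((p : ℂ) ^ s * p - 1) := by
  rw [← aux_J p s hs, aux_haar_pi]
  have := integral_fintype_prod_eq_prod (μ := fun _ : Fin n => padicHaarOne p)
    (fun k (t : ℤ_[p]) => if k = i then (‖(p : ℤ_[p]) * t‖ : ℂ) ^ s else 1)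
  simp only [Finset.prod_ite_eq', Finset.mem_univ, if_true] at this
  rw [this, Finset.prod_eq_single i]
  · simp
  · intro b _ hb; simp [hb]
  · simp

lemma aux_int_two (p : ℕ) [hp : Fact p.Prime] {n : ℕ} (i j : Fin n) (hij : i ≠ j) (s s' : ℂ)
    (hs : 0 < s.re) (hs' : 0 < s'.re) :
    ∫ x, (‖(p : ℤ_[p]) * x i‖ : ℂ) ^ s * (‖(p : ℤ_[p]) * x j‖ : ℂ) ^ s' ∂(padicHaar p n)
      = ((p : ℂ) - 1) / ((p : ℂ) ^ s * p - 1) * (((p : ℂ) - 1) / ((p : ℂ) ^ s' * p - 1)) := by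
  rw [← aux_J p s hs, ← aux_J p s' hs', aux_haar_pi]
  have := integral_fintype_prod_eq_prod (μ := fun _ : Fin n => padicHaarOne p)
    (fun k (t : ℤ_[p]) => (if k = i then (‖(p : ℤ_[p]) * t‖ : ℂ) ^ s else 1) *
      (if k = j then (‖(p : ℤ_[p]) * t‖ : ℂ) ^ s' else 1))
  simp only [Finset.prod_mul_distrib, Finset.prod_ite_eq', Finset.mem_univ, if_true] at this
  rw [this, ← Finset.prod_subset (Finset.subset_univ {i, j}), Finset.prod_pair hij]
  · simp [hij, hij.symm]
  · intro k _ hk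
    simp only [Finset.mem_insert, Finset.mem_singleton, not_or] at hk
    simp [hk]

lemma aux_comp (p : ℕ) [hp : Fact p.Prime] {n : ℕ} (T : (Fin n → ℤ_[p]) → (Fin n → ℤ_[p]))
    (hT : Isometry T) (F : (Fin n → ℤ_[p]) → ℂ) (hF : Measurable F) :
    ∫ t, F (T t) ∂(padicHaar p n) = ∫ t, F t ∂(padicHaar p n) := by
  conv_rhs => rw [← aux_isometry_mp (padicHaar p n) T hT]
  rw [integral_map hT.continuous.aemeasurable hF.aestronglyMeasurable]

lemma aux_redp {p n : ℕ} [Fact p.Prime] (f : MvPolynomial (Fin n) ℤ_[p]) (c : Fin n → ℤ_[p]) :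
    eval (fun i => PadicInt.toZMod (c i)) (redp f) = PadicInt.toZMod (eval c f) := by
  rw [redp, eval_map, ← eval₂_id, eval₂_comp_left]
  simp [Function.comp_def]

lemma aux_local {p : ℕ} [hp : Fact p.Prime] {n : ℕ} (f g : MvPolynomial (Fin n) ℤ_[p])
    (h1 : ¬ ∃ a : Fin n → ℤ_[p], (∀ i, IsUnit (a i)) ∧
      (p : ℤ_[p]) ∣ eval a f ∧ ∀ i, (p : ℤ_[p]) ∣ eval a (pderiv i f))
    (h2 : ¬ ∃ a : Fin n → ℤ_[p], (∀ i, IsUnit (a i)) ∧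
      (p : ℤ_[p]) ∣ eval a g ∧ ∀ i, (p : ℤ_[p]) ∣ eval a (pderiv i g))
    (h3 : ¬ ∃ a : Fin n → ℤ_[p], (∀ i, IsUnit (a i)) ∧
      (p : ℤ_[p]) ∣ eval a f ∧ (p : ℤ_[p]) ∣ eval a g ∧
      ∀ i j : Fin n, i < j → (p : ℤ_[p]) ∣
        eval a (pderiv i f * pderiv j g - pderiv j f * pderiv i g))
    (s : ℂ) (hs : 0 < s.re) (c : Fin n → ℤ_[p]) (hc : ∀ i, IsUnit (c i)) :
    ∫ t, (‖eval (c + (p : ℤ_[p]) • t) f‖ : ℂ) ^ s * (‖eval (c + (p : ℤ_[p]) • t) g‖ : ℂ)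
        ∂(padicHaar p n)
      = (open Classical in if (p : ℤ_[p]) ∣ eval c f then ((p : ℂ) - 1) / ((p : ℂ) ^ s * p - 1) else 1)
        * (open Classical in if (p : ℤ_[p]) ∣ eval c g then ((p : ℂ) - 1) / ((p : ℂ) * p - 1) else 1) := by
  have hone : ∀ e : MvPolynomial (Fin n) ℤ_[p], ¬ (p : ℤ_[p]) ∣ eval c e →
      ∀ t, ‖eval (c + (p : ℤ_[p]) • t) e‖ = 1 := by
    intro e he t
    apply aux_norm_one
    intro h
    exact he ((dvd_sub_right h).1 (aux_eval_congr e c t p))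
  have hm : ∀ i (s : ℂ), Measurable (fun x : Fin n → ℤ_[p] => (‖(p : ℤ_[p]) * x i‖ : ℂ) ^ s) := by
    intro i s
    exact (aux_meas_cpow s).comp
      (by fun_prop : Continuous (fun x : Fin n → ℤ_[p] => (p : ℤ_[p]) * x i)).measurable
  by_cases hf : (p : ℤ_[p]) ∣ eval c f <;> by_cases hg : (p : ℤ_[p]) ∣ eval c g
  · have : ∃ i j : Fin n, i < j ∧ ¬ (p : ℤ_[p]) ∣
        eval c (pderiv i f * pderiv j g - pderiv j f * pderiv i g) := by
      by_contra hcon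
      push Not at hcon
      exact h3 ⟨c, hc, hf, hg, hcon⟩
    obtain ⟨i, j, hij, hD⟩ := this
    obtain ⟨T, hT, hTf, hTg⟩ := aux_two f g c hf hg i j hij.ne hD
    have h := aux_comp p T hT _ ((hm i s).mul (hm j 1))
    have h' := aux_int_two p i j hij.ne s 1 hs (by simp)
    simp only [Complex.cpow_one] at h h'
    simp only [hTf, hTg, hf, hg, if_true]
    exact h.trans h'
  · have : ∃ i, ¬ (p : ℤ_[p]) ∣ eval c (pderiv i f) := by
      by_contra hcon
      push Not at hcon
      exact h1 ⟨c, hc, hf, hcon⟩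
    obtain ⟨i, hD⟩ := this
    obtain ⟨T, hT, hTf⟩ := aux_one f c hf i hD
    have h := aux_comp p T hT _ (hm i s)
    simp only [hTf, hone g hg, hf, hg, if_true, if_false, Complex.ofReal_one, mul_one]
    exact h.trans (aux_int_one p i s hs)
  · have : ∃ i, ¬ (p : ℤ_[p]) ∣ eval c (pderiv i g) := by
      by_contra hcon
      push Not at hcon
      exact h2 ⟨c, hc, hg, hcon⟩
    obtain ⟨i, hD⟩ := this
    obtain ⟨T, hT, hTf⟩ := aux_one g c hg i hD
    have h := aux_comp p T hT _ (hm i 1)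
    have h' := aux_int_one p i 1 (by simp)
    simp only [Complex.cpow_one] at h h'
    simp only [hTf, hone f hf, hf, hg, if_true, if_false, Complex.ofReal_one, Complex.one_cpow,
      one_mul]
    exact h.trans h'
  · simp [hone f hf, hone g hg, hf, hg]

theorem integral_units_poly_measure (p : ℕ) [Fact p.Prime] (n : ℕ) (hn : 2 ≤ n)
    (f g : MvPolynomial (Fin n) ℤ_[p])
    (N : ℕ) (hN : N = Set.ncard {a : Fin n → ZMod p | (∀ i, a i ≠ 0) ∧
      eval a (redp f) = 0 ∧ eval a (redp g) ≠ 0})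
    (P : ℕ) (hP : P = Set.ncard {a : Fin n → ZMod p | (∀ i, a i ≠ 0) ∧
      eval a (redp f) ≠ 0 ∧ eval a (redp g) = 0})
    (Q : ℕ) (hQ : Q = Set.ncard {a : Fin n → ZMod p | (∀ i, a i ≠ 0) ∧
      eval a (redp f) = 0 ∧ eval a (redp g) = 0})
    (h1 : ¬ ∃ a : Fin n → ℤ_[p], (∀ i, IsUnit (a i)) ∧
      (p : ℤ_[p]) ∣ eval a f ∧ ∀ i, (p : ℤ_[p]) ∣ eval a (pderiv i f))
    (h2 : ¬ ∃ a : Fin n → ℤ_[p], (∀ i, IsUnit (a i)) ∧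
      (p : ℤ_[p]) ∣ eval a g ∧ ∀ i, (p : ℤ_[p]) ∣ eval a (pderiv i g))
    (h3 : ¬ ∃ a : Fin n → ℤ_[p], (∀ i, IsUnit (a i)) ∧
      (p : ℤ_[p]) ∣ eval a f ∧ (p : ℤ_[p]) ∣ eval a g ∧
      ∀ i j : Fin n, i < j → (p : ℤ_[p]) ∣
        eval a (pderiv i f * pderiv j g - pderiv j f * pderiv i g))
    (s : ℂ) (hs : 0 < s.re) :
    ∫ x in unitsSet p n, (‖eval x f‖ : ℂ) ^ s * (‖eval x g‖ : ℂ) ∂(padicHaar p n)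
      = (p : ℂ) ^ (-(n : ℤ)) * (((p : ℂ) - 1) ^ n
        - (p : ℂ) * N * ((p : ℂ) ^ s - 1) / ((p : ℂ) ^ (s + 1) - 1)
        - P * (p : ℂ) / ((p : ℂ) + 1)
        - (p : ℂ) * Q * ((p : ℂ) ^ s * ((p : ℂ) + 1) - 2)
            / (((p : ℂ) ^ (s + 1) - 1) * ((p : ℂ) + 1))) := by
  classical
  have hpr : p.Prime := Fact.out
  have hp0 : (p : ℂ) ≠ 0 := by exact_mod_cast hpr.ne_zero
  have hps := aux_p_cpow_ne hpr s hs
  have hps1 : (p : ℂ) ^ (s + 1) = (p : ℂ) ^ s * p := by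
    rw [Complex.cpow_add _ _ hp0, Complex.cpow_one]
  have hp1 : (p : ℂ) + 1 ≠ 0 := by exact_mod_cast Nat.succ_ne_zero p
  have hp2 : (p : ℂ) - 1 ≠ 0 := by
    rw [sub_ne_zero]; exact_mod_cast hpr.one_lt.ne'
  have hp3 : (p : ℂ) * p - 1 ≠ 0 := by
    have : (p : ℂ) * p - 1 = (p + 1) * (p - 1) := by ring
    rw [this]; exact mul_ne_zero hp1 hp2
  set F : (Fin n → ℤ_[p]) → ℂ := fun x => (‖eval x f‖ : ℂ) ^ s * (‖eval x g‖ : ℂ) with hF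
  have hsurj := ZMod.ringHom_surjective (PadicInt.toZMod (p := p))
  obtain ⟨hmeas, hint⟩ := aux_class (padicHaar p n)
    ((PadicInt.toZMod (p := p)).toAddMonoidHom.compLeft (Fin n))
    (fun a => ⟨fun i => (hsurj (a i)).choose, funext fun i => (hsurj (a i)).choose_spec⟩)
    (DistribSMul.toAddMonoidHom (Fin n → ℤ_[p]) (p : ℤ_[p]))
    (by
      have : Continuous (fun x : Fin n → ℤ_[p] => (p : ℤ_[p]) • x) := by fun_prop
      exact this)
    (fun a b h => by
      funext i
      exact mul_left_cancel₀ PadicInt.prime_p.ne_zero (congrFun h i))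
    (fun x => by
      constructor
      · intro h
        have h' : ∀ i, ∃ t, x i = p * t := fun i => (aux_toZMod_zero _).1 (congrFun h i)
        choose t ht using h'
        exact ⟨t, funext fun i => (ht i).symm⟩
      · rintro ⟨t, rfl⟩
        funext i
        exact (aux_toZMod_zero _).2 ⟨t i, rfl⟩)
  set r := (PadicInt.toZMod (p := p)).toAddMonoidHom.compLeft (Fin n) with hr
  have hrx : ∀ x, r x = fun i => PadicInt.toZMod (x i) := fun x => rfl
  have hFi : Integrable F (padicHaar p n) := by
    have hcont : ∀ e : MvPolynomial (Fin n) ℤ_[p], Continuous fun x => eval x e :=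
      fun e => MvPolynomial.continuous_eval e
    refine Integrable.of_bound (Measurable.aestronglyMeasurable ?_) 1
      (Filter.Eventually.of_forall fun t => ?_)
    · refine ((aux_meas_cpow s).comp (hcont f).measurable).mul ?_
      exact Complex.measurable_ofReal.comp (hcont g).norm.measurable
    · rw [hF, norm_mul]
      refine mul_le_one₀ (aux_norm_cpow_le _ s hs) (norm_nonneg _) ?_
      simpa using PadicInt.norm_le_one (eval t g)
  have hunit : ∀ x : ℤ_[p], IsUnit x ↔ PadicInt.toZMod x ≠ 0 := by
    intro x
    rw [Ne, aux_toZMod_zero, ← PadicInt.norm_lt_one_iff_dvd, ← PadicInt.not_isUnit_iff, not_not]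
  set S : Finset (Fin n → ZMod p) := Finset.univ.filter (fun a => ∀ i, a i ≠ 0) with hS
  have hU : unitsSet p n = ⋃ a ∈ S, r ⁻¹' {a} := by
    ext x
    simp [unitsSet, hS, hunit, hrx]
  have hsum : ∫ x in unitsSet p n, F x ∂(padicHaar p n)
      = ∑ a ∈ S, ∫ x in r ⁻¹' {a}, F x ∂(padicHaar p n) := by
    rw [hU]
    refine integral_biUnion_finset S (fun a _ => hmeas a) ?_ (fun a _ => hFi.integrableOn)
    intro a _ b _ hab
    exact Set.disjoint_left.2 fun x hx hx' => hab (by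
          simp only [Set.mem_preimage, Set.mem_singleton_iff] at hx hx'; rw [← hx, ← hx'])
  have hval : ∀ a ∈ S, ∫ x in r ⁻¹' {a}, F x ∂(padicHaar p n) = (p : ℂ) ^ (-(n : ℤ)) *
      (1 - (if eval a (redp f) = 0 ∧ eval a (redp g) ≠ 0 then
          (p : ℂ) * ((p : ℂ) ^ s - 1) / ((p : ℂ) ^ (s + 1) - 1) else 0)
        - (if eval a (redp f) ≠ 0 ∧ eval a (redp g) = 0 then (p : ℂ) / ((p : ℂ) + 1) else 0)
        - (if eval a (redp f) = 0 ∧ eval a (redp g) = 0 then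
            (p : ℂ) * ((p : ℂ) ^ s * ((p : ℂ) + 1) - 2)
            / (((p : ℂ) ^ (s + 1) - 1) * ((p : ℂ) + 1)) else 0)) := by
    intro a ha
    obtain ⟨c, rfl⟩ : ∃ c, r c = a :=
      ⟨fun i => (hsurj (a i)).choose, funext fun i => (hsurj (a i)).choose_spec⟩
    have hc : ∀ i, IsUnit (c i) := by
      intro i
      rw [hunit]
      exact (Finset.mem_filter.1 ha).2 i
    have hl := aux_local f g h1 h2 h3 s hs c hc
    rw [hint c F]
    have hcard : ((Fintype.card (Fin n → ZMod p) : ℕ) : ℂ)⁻¹ = (p : ℂ) ^ (-(n : ℤ)) := by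
      simp [ZMod.card]
    rw [hcard]
    congr 1
    refine hl.trans ?_
    rw [hrx, aux_redp, aux_redp, hps1]
    simp only [Ne, aux_toZMod_zero]
    have e1 : ((p : ℂ) - 1) / ((p : ℂ) * p - 1) = 1 / (p + 1) := by
      rw [div_eq_div_iff hp3 hp1]; ring
    rw [e1]
    clear hl
    generalize (p : ℂ) ^ s = z at hps ⊢
    have hps' : (p : ℂ) * z - 1 ≠ 0 := by rwa [mul_comm]
    by_cases hf : (p : ℤ_[p]) ∣ eval c f <;> by_cases hg : (p : ℤ_[p]) ∣ eval c g <;>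
      simp only [hf, hg, if_true, if_false, not_true, not_false_iff, and_true, true_and, and_false,
        false_and, sub_zero, mul_one, one_mul]
    · field_simp
      ring
    · field_simp
      ring
    · field_simp
      ring
  rw [hsum, Finset.sum_congr rfl hval, ← Finset.mul_sum]
  congr 1
  simp only [Finset.sum_sub_distrib, ← Finset.sum_filter, Finset.sum_const, nsmul_eq_mul, mul_one]
  have hcS : (S.card : ℂ) = ((p : ℂ) - 1) ^ n := by
    have : S = Fintype.piFinset (fun _ : Fin n => (Finset.univ.erase (0 : ZMod p))) := by
      ext a; simp [hS]
    rw [this, Fintype.card_piFinset]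
    simp [ZMod.card, Nat.cast_sub hpr.one_le]
  have hcount : ∀ (A : (Fin n → ZMod p) → Prop) [DecidablePred A],
      Set.ncard {a | (∀ i, a i ≠ 0) ∧ A a} = (S.filter A).card := by
    intro A _
    rw [← Set.ncard_coe_finset]
    congr 1
    ext a
    simp [hS]
  rw [hcount] at hN hP hQ
  rw [hcS, ← hN, ← hP, ← hQ]
  ring
end
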